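/- Let p ∈ (1,∞), let Ω ⊆ ℝ^d be a domain, and let V ∈ L^∞_loc(Ω) be real-valued such that Q_V is critical in Ω with ground state φ₀. Let V₀ ∈ L^∞(Ω) be such that the support of V₀ is a compact subset of Ω. Then there exists τ₊ ∈ (0,∞] such that Q_{V+sV₀} is subcritical in Ω for every s ∈ (0, τ₊) if and only if ∫_Ω V₀(x) φ₀(x)^p dx > 0. -/

import Mathlib

open MeasureTheory Filter
open scoped Topology RealInnerProductSpace

noncomputable section

abbrev Ed (d : ℕ) := EuclideanSpace ℝ (Fin d)

/-- A smooth test function compactly supported inside Ω. -/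
def IsTestOn {d : ℕ} (Ω : Set (Ed d)) (u : Ed d → ℝ) : Prop :=
  ContDiff ℝ (⊤ : ℕ∞) u ∧ HasCompactSupport u ∧ tsupport u ⊆ Ω

/-- `V ∈ L^∞_loc(Ω)`. -/
def LocBddOn {d : ℕ} (Ω : Set (Ed d)) (V : Ed d → ℝ) : Prop :=
  Measurable V ∧ ∀ K : Set (Ed d), IsCompact K → K ⊆ Ω →
    ∃ M : ℝ, ∀ᵐ x ∂(volume : Measure (Ed d)), x ∈ K → |V x| ≤ M

/-- The functional `Q_V(u) = ∫_Ω (|∇u|^p + V|u|^p) dx`. -/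
def Qp {d : ℕ} (p : ℝ) (Ω : Set (Ed d)) (V : Ed d → ℝ) (u : Ed d → ℝ) : ℝ :=
  ∫ x in Ω, (‖gradient u x‖ ^ p + V x * |u x| ^ p)

/-- `Q_V` is nonnegative in Ω. -/
def NonnegOn {d : ℕ} (p : ℝ) (Ω : Set (Ed d)) (V : Ed d → ℝ) : Prop :=
  ∀ u, IsTestOn Ω u → 0 ≤ Qp p Ω V u

/-- `Q_V` is subcritical (strictly positive) in Ω: there is a continuous function
`W > 0` on Ω with `Q_V(u) ≥ ∫_Ω W|u|^p` for all test functions `u`. -/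
def SubcriticalOn {d : ℕ} (p : ℝ) (Ω : Set (Ed d)) (V : Ed d → ℝ) : Prop :=
  ∃ W : Ed d → ℝ, ContinuousOn W Ω ∧ (∀ x ∈ Ω, 0 < W x) ∧
    ∀ u, IsTestOn Ω u → (∫ x in Ω, W x * |u x| ^ p) ≤ Qp p Ω V u

/-- A null sequence for `Q_V` in Ω. -/
def NullSeqOn {d : ℕ} (p : ℝ) (Ω : Set (Ed d)) (V : Ed d → ℝ)
    (un : ℕ → Ed d → ℝ) : Prop :=
  (∀ n, IsTestOn Ω (un n)) ∧ (∀ n x, 0 ≤ un n x) ∧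
  (∃ B : Set (Ed d), IsOpen B ∧ IsCompact (closure B) ∧ closure B ⊆ Ω ∧
    ∀ n, (∫ x in B, |un n x| ^ p) = 1) ∧
  Tendsto (fun n => Qp p Ω V (un n)) atTop (𝓝 0)

/-- A ground state of `Q_V` in Ω: a positive C¹ function on Ω that is the limit of
a null sequence in `L^p(K)` for every compact `K ⊆ Ω`. -/
def IsGroundStateOn {d : ℕ} (p : ℝ) (Ω : Set (Ed d)) (V : Ed d → ℝ)
    (φ : Ed d → ℝ) : Prop :=
  ContDiffOn ℝ 1 φ Ω ∧ (∀ x ∈ Ω, 0 < φ x) ∧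
  ∃ un, NullSeqOn p Ω V un ∧ ∀ K : Set (Ed d), IsCompact K → K ⊆ Ω →
    Tendsto (fun n => ∫ x in K, |un n x - φ x| ^ p) atTop (𝓝 0)

/-- `Q_V` is critical in Ω. -/
def CriticalOn {d : ℕ} (p : ℝ) (Ω : Set (Ed d)) (V : Ed d → ℝ) : Prop :=
  NonnegOn p Ω V ∧ ∃ φ, IsGroundStateOn p Ω V φ

/-- A positive weak supersolution of `-Δ_p v + V|v|^{p-2}v = 0` in Ω. -/
def IsSupersolOn {d : ℕ} (p : ℝ) (Ω : Set (Ed d)) (V : Ed d → ℝ)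
    (v : Ed d → ℝ) : Prop :=
  ContDiffOn ℝ 1 v Ω ∧ (∀ x ∈ Ω, 0 < v x) ∧
  ∀ φ, IsTestOn Ω φ → (∀ x, 0 ≤ φ x) →
    0 ≤ ∫ x in Ω, (‖gradient v x‖ ^ (p - 2) * ⟪gradient v x, gradient φ x⟫ +
      V x * v x ^ (p - 1) * φ x)

/-- A positive weak solution of `-Δ_p v + V|v|^{p-2}v = 0` in Ω. -/
def IsSolOn {d : ℕ} (p : ℝ) (Ω : Set (Ed d)) (V : Ed d → ℝ)
    (v : Ed d → ℝ) : Prop :=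
  ContDiffOn ℝ 1 v Ω ∧ (∀ x ∈ Ω, 0 < v x) ∧
  ∀ φ, IsTestOn Ω φ →
    (∫ x in Ω, (‖gradient v x‖ ^ (p - 2) * ⟪gradient v x, gradient φ x⟫ +
      V x * v x ^ (p - 1) * φ x)) = 0


section alg
variable {E : Type*} [NormedAddCommGroup E] [InnerProductSpace ℝ E]

def FF (p : ℝ) (A : E) : E := ‖A‖ ^ (p - 2) • A

def Breg (p : ℝ) (A B : E) : ℝ := ‖A‖ ^ p - ‖B‖ ^ p - p * ⟪FF p B, A - B⟫

lemma rpow_sub_two_mul {a p : ℝ} (ha : 0 ≤ a) (hp : 1 < p) : a ^ (p - 2) * a = a ^ (p - 1) := by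
  rcases ha.eq_or_lt with rfl | h
  · rw [Real.zero_rpow (by linarith : p - 1 ≠ 0)]; simp
  · nth_rewrite 2 [← Real.rpow_one a]
    rw [← Real.rpow_add h]; ring_nf

lemma rpow_sub_one_mul' {a p : ℝ} (ha : 0 ≤ a) (hp : 1 < p) : a ^ (p - 1) * a = a ^ p := by
  rcases ha.eq_or_lt with rfl | h
  · rw [Real.zero_rpow (by linarith : p ≠ 0)]; simp
  · nth_rewrite 2 [← Real.rpow_one a]
    rw [← Real.rpow_add h]; ring_nf

lemma norm_FF {p : ℝ} (hp : 1 < p) (A : E) : ‖FF p A‖ = ‖A‖ ^ (p - 1) := by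
  unfold FF
  rw [norm_smul, Real.norm_of_nonneg (by positivity), rpow_sub_two_mul (norm_nonneg _) hp]

lemma FF_zero {p : ℝ} : FF p (0 : E) = 0 := by simp [FF]

lemma continuous_FF {p : ℝ} (hp : 1 < p) : Continuous (FF p : E → E) := by
  rw [continuous_iff_continuousAt]
  intro x
  by_cases hx : x = 0
  · subst hx
    unfold ContinuousAt
    rw [FF_zero, tendsto_zero_iff_norm_tendsto_zero]
    simp_rw [norm_FF hp]
    have : Continuous (fun A : E => ‖A‖ ^ (p - 1)) :=
      continuous_norm.rpow_const (fun _ => Or.inr (by linarith))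
    have h := this.tendsto 0
    simpa [Real.zero_rpow (by linarith : p - 1 ≠ 0)] using h
  · unfold FF
    exact (continuousAt_id.norm.rpow_const (Or.inl (by simpa using hx))).smul continuousAt_id

lemma inner_FF_self {p : ℝ} (hp : 1 < p) (A : E) : ⟪FF p A, A⟫ = ‖A‖ ^ p := by
  unfold FF
  rw [real_inner_smul_left, real_inner_self_eq_norm_sq, sq, ← mul_assoc,
    rpow_sub_two_mul (norm_nonneg _) hp, rpow_sub_one_mul' (norm_nonneg _) hp]

lemma FF_smul {p : ℝ} (c : ℝ) (A : E) : FF p (c • A) = (|c| ^ (p - 2) * c) • FF p A := by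
  unfold FF
  rw [norm_smul, Real.norm_eq_abs, Real.mul_rpow (abs_nonneg _) (norm_nonneg _), smul_smul, smul_smul]
  congr 1; ring

lemma abs_rpow_mul_self {p : ℝ} (hp : 1 < p) (c : ℝ) : |c| ^ (p - 2) * c * c = |c| ^ p := by
  rw [mul_assoc, ← abs_mul_abs_self c, ← mul_assoc, rpow_sub_two_mul (abs_nonneg _) hp,
    rpow_sub_one_mul' (abs_nonneg _) hp]

/-- scalar strict tangent inequality -/
lemma tangent_lt {p a b : ℝ} (hp : 1 < p) (ha : 0 ≤ a) (hb : 0 ≤ b) (hab : a ≠ b) :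
    b ^ p + p * (b ^ (p - 1) * (a - b)) < a ^ p := by
  rcases hb.eq_or_lt with rfl | h
  · rw [Real.zero_rpow (by linarith), Real.zero_rpow (by linarith)]
    have : 0 < a := lt_of_le_of_ne ha (Ne.symm hab)
    have := Real.rpow_pos_of_pos this p
    linarith
  · have h1 := one_add_mul_self_lt_rpow_one_add (s := a / b - 1) (p := p)
      (by have : 0 ≤ a / b := by positivity
          linarith)
      (by intro h2; apply hab; field_simp at h2; linarith) hp
    have h2 : (1 + (a / b - 1)) ^ p = a ^ p / b ^ p := by
      rw [← Real.div_rpow ha hb]; congr 1; ring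
    rw [h2] at h1
    have hbp : 0 < b ^ p := Real.rpow_pos_of_pos h p
    rw [lt_div_iff₀ hbp] at h1
    have h3 := rpow_sub_one_mul' hb hp
    have : b ^ p + p * (b ^ (p - 1) * (a - b)) = (1 + p * (a / b - 1)) * b ^ p := by
      rw [← h3]; field_simp
    linarith

lemma breg_pos {p : ℝ} (hp : 1 < p) {A B : E} (h : A ≠ B) : 0 < Breg p A B := by
  unfold Breg
  rw [inner_sub_right, inner_FF_self hp]
  have h0 : ⟪FF p B, A⟫ = ‖B‖ ^ (p - 2) * ⟪B, A⟫ := by unfold FF; rw [real_inner_smul_left]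
  have hBp := rpow_sub_one_mul' (norm_nonneg B) hp
  have hB2 := rpow_sub_two_mul (norm_nonneg B) hp
  have h1 : ‖B‖ ^ (p - 2) * ⟪B, A⟫ ≤ ‖B‖ ^ (p - 1) * ‖A‖ := by
    rw [← hB2, mul_assoc]
    exact mul_le_mul_of_nonneg_left (real_inner_le_norm B A) (by positivity)
  rw [h0]
  by_cases hn : ‖A‖ = ‖B‖
  · -- strict Cauchy-Schwarz
    have hB0 : 0 < ‖B‖ := by
      rcases (norm_nonneg B).eq_or_lt with h2 | h2
      · exfalso; apply h
        rw [← h2, norm_eq_zero] at hn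
        rw [hn, norm_eq_zero.1 h2.symm]
      · exact h2
    have h3 : ⟪B, A⟫ < ‖B‖ * ‖B‖ := by
      have h4 : 0 < ‖A - B‖ ^ 2 := by
        have := norm_pos_iff.2 (sub_ne_zero.2 h); positivity
      rw [norm_sub_sq_real, hn, real_inner_comm] at h4
      nlinarith
    have h5 : ‖B‖ ^ (p - 2) * ⟪B, A⟫ < ‖B‖ ^ p := by
      rw [← hBp, ← hB2, mul_assoc]
      exact mul_lt_mul_of_pos_left h3 (Real.rpow_pos_of_pos hB0 _)
    rw [hn]; nlinarith
  · have := tangent_lt hp (norm_nonneg A) (norm_nonneg B) hn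
    have h6 : p * (‖B‖ ^ (p - 2) * ⟪B, A⟫) ≤ p * (‖B‖ ^ (p - 1) * ‖A‖) :=
      mul_le_mul_of_nonneg_left h1 (by linarith)
    nlinarith

lemma breg_self {p : ℝ} (A : E) : Breg p A A = 0 := by simp [Breg]

lemma breg_nonneg {p : ℝ} (hp : 1 < p) (A B : E) : 0 ≤ Breg p A B := by
  by_cases h : A = B
  · rw [h, breg_self]
  · exact (breg_pos hp h).le

lemma continuous_norm_rpow {G X : Type*} [NormedAddCommGroup G] [TopologicalSpace X] {p : ℝ}
    (hp : 1 < p) {f : X → G} (hf : Continuous f) : Continuous (fun x => ‖f x‖ ^ p) :=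
  hf.norm.rpow_const (fun _ => Or.inr (by linarith))

lemma continuous_breg {X : Type*} [TopologicalSpace X] {p : ℝ} (hp : 1 < p) {f g : X → E}
    (hf : Continuous f) (hg : Continuous g) :
    Continuous (fun x => Breg p (f x) (g x)) := by
  unfold Breg
  exact ((continuous_norm_rpow hp hf).sub (continuous_norm_rpow hp hg)).sub
    (continuous_const.mul (((continuous_FF hp).comp hg).inner (hf.sub hg)))

lemma breg_smul {p : ℝ} (hp : 1 < p) {t : ℝ} (ht : 0 ≤ t) (A B : E) :
    Breg p (t • A) (t • B) = t ^ p * Breg p A B := by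
  unfold Breg
  rw [FF_smul, ← smul_sub, real_inner_smul_left, real_inner_smul_right, ← mul_assoc _ t,
    abs_rpow_mul_self hp, norm_smul, norm_smul, Real.norm_of_nonneg ht, abs_of_nonneg ht,
    Real.mul_rpow ht (norm_nonneg _), Real.mul_rpow ht (norm_nonneg _)]
  ring

end alg

lemma homog_bound {G : Type*} [NormedAddCommGroup G] [NormedSpace ℝ G] [ProperSpace G]
    {p : ℝ} (hp : 1 < p) (f g : G → ℝ) (hf : Continuous f) (hg : Continuous g)
    (hfh : ∀ t : ℝ, 0 ≤ t → ∀ x, f (t • x) = t ^ p * f x)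
    (hgh : ∀ t : ℝ, 0 ≤ t → ∀ x, g (t • x) = t ^ p * g x)
    (hg0 : ∀ x, 0 ≤ g x)
    (hpos : ∀ x, x ≠ 0 → 0 ≤ f x → 0 < g x) :
    ∃ C : ℝ, 0 < C ∧ ∀ x, f x ≤ C * g x := by
  have key : ∃ C : ℝ, 0 < C ∧ ∀ x ∈ Metric.sphere (0 : G) 1, f x ≤ C * g x := by
    set S : Set G := Metric.sphere (0 : G) 1 ∩ f ⁻¹' Set.Ici 0 with hS
    have hSc : IsCompact S := (isCompact_sphere 0 1).inter_right (isClosed_Ici.preimage hf)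
    by_cases hne : S.Nonempty
    · obtain ⟨x0, hx0, hmin⟩ := hSc.exists_isMinOn hne hg.continuousOn
      obtain ⟨x1, hx1, hmax⟩ := hSc.exists_isMaxOn hne hf.continuousOn
      have hm : 0 < g x0 := hpos x0 (by
        intro h; have := hx0.1; rw [h] at this; simp at this) hx0.2
      have hf1 : 0 ≤ f x1 := hx1.2
      refine ⟨f x1 / g x0 + 1, by positivity, fun x hx => ?_⟩
      by_cases hfx : 0 ≤ f x
      · have hxS : x ∈ S := ⟨hx, hfx⟩
        have h1 : f x ≤ f x1 := hmax hxS
        have h2 : g x0 ≤ g x := hmin hxS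
        calc f x ≤ f x1 := h1
          _ = f x1 / g x0 * g x0 := by field_simp
          _ ≤ f x1 / g x0 * g x := by gcongr
          _ ≤ (f x1 / g x0 + 1) * g x := by nlinarith [hg0 x]
      · have : 0 ≤ (f x1 / g x0 + 1) * g x := by have := hg0 x; positivity
        linarith
    · refine ⟨1, one_pos, fun x hx => ?_⟩
      have : ¬ 0 ≤ f x := fun h => hne ⟨x, hx, h⟩
      have := hg0 x
      linarith
  obtain ⟨C, hC, h⟩ := key
  refine ⟨C, hC, fun x => ?_⟩
  by_cases hx : x = 0
  · have h1 := hfh 0 le_rfl 0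
    rw [Real.zero_rpow (by linarith)] at h1
    simp at h1
    rw [hx, h1]; exact mul_nonneg hC.le (hg0 _)
  · have hn : 0 < ‖x‖ := norm_pos_iff.2 hx
    have h1 := h (‖x‖⁻¹ • x) (by simp [norm_smul, hn.ne'])
    have h2 : x = ‖x‖ • (‖x‖⁻¹ • x) := by rw [smul_smul, mul_inv_cancel₀ hn.ne', one_smul]
    rw [h2, hfh _ hn.le, hgh _ hn.le]
    have : 0 ≤ ‖x‖ ^ p := by positivity
    nlinarith

lemma breg_coercive (d : ℕ) {p : ℝ} (hp : 1 < p) {δ : ℝ} (hδ : 0 < δ) :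
    ∃ C : ℝ, 0 < C ∧ ∀ A B : Ed d, ‖A - B‖ ^ p ≤ C * Breg p A B + δ * ‖B‖ ^ p := by
  obtain ⟨C, hC, h⟩ := homog_bound (G := Ed d × Ed d) hp
    (fun x => ‖x.1 - x.2‖ ^ p - δ * ‖x.2‖ ^ p) (fun x => Breg p x.1 x.2)
    ((continuous_norm_rpow hp (by fun_prop)).sub
      (continuous_const.mul (continuous_norm_rpow hp (by fun_prop))))
    (continuous_breg hp (by fun_prop) (by fun_prop))
    (fun t ht x => by
      simp only [Prod.smul_fst, Prod.smul_snd, ← smul_sub, norm_smul, Real.norm_of_nonneg ht,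
        Real.mul_rpow ht (norm_nonneg _)]
      ring)
    (fun t ht x => by simp only [Prod.smul_fst, Prod.smul_snd, breg_smul hp ht])
    (fun x => breg_nonneg hp _ _)
    (fun x hx h => by
      apply breg_pos hp
      intro h1
      rw [h1, sub_self, norm_zero, Real.zero_rpow (by linarith)] at h
      have h2 : ‖x.2‖ ^ p ≤ 0 := by nlinarith
      have h3 : x.2 = 0 := by
        by_contra h4
        have := Real.rpow_pos_of_pos (norm_pos_iff.2 h4) p
        linarith
      exact hx (Prod.ext (h1.trans h3) h3))
  exact ⟨C, hC, fun A B => by have := h (A, B); simp only at this; linarith⟩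

lemma add_rpow_bound {G : Type*} [NormedAddCommGroup G] [NormedSpace ℝ G] [ProperSpace G]
    {p : ℝ} (hp : 1 < p) {δ : ℝ} (hδ : 0 < δ) :
    ∃ C : ℝ, 0 < C ∧ ∀ A X : G, ‖A + X‖ ^ p ≤ (1 + δ) * ‖A‖ ^ p + C * ‖X‖ ^ p := by
  obtain ⟨C, hC, h⟩ := homog_bound (G := G × G) hp
    (fun x => ‖x.1 + x.2‖ ^ p - (1 + δ) * ‖x.1‖ ^ p) (fun x => ‖x.2‖ ^ p)
    ((continuous_norm_rpow hp (by fun_prop)).sub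
      (continuous_const.mul (continuous_norm_rpow hp (by fun_prop))))
    (continuous_norm_rpow hp (by fun_prop))
    (fun t ht x => by
      simp only [Prod.smul_fst, Prod.smul_snd, ← smul_add, norm_smul, Real.norm_of_nonneg ht,
        Real.mul_rpow ht (norm_nonneg _)]
      ring)
    (fun t ht x => by
      simp only [Prod.smul_snd, norm_smul, Real.norm_of_nonneg ht,
        Real.mul_rpow ht (norm_nonneg _)])
    (fun x => by positivity)
    (fun x hx h => by
      apply Real.rpow_pos_of_pos
      rw [norm_pos_iff]
      intro h1
      rw [h1, add_zero] at h
      have h2 : ‖x.1‖ ^ p ≤ 0 := by nlinarith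
      have h3 : x.1 = 0 := by
        by_contra h4
        have := Real.rpow_pos_of_pos (norm_pos_iff.2 h4) p
        linarith
      exact hx (Prod.ext h3 h1))
  exact ⟨C, hC, fun A X => by have := h (A, X); simp only at this; linarith⟩

lemma abs_rpow_diff {p : ℝ} (hp : 1 < p) {δ : ℝ} (hδ : 0 < δ) :
    ∃ C : ℝ, 0 < C ∧ ∀ a b : ℝ, |(|a| ^ p - |b| ^ p)| ≤ δ * |a| ^ p + C * |a - b| ^ p := by
  have hc : ∀ {X : Type} [TopologicalSpace X] {f : X → ℝ}, Continuous f →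
      Continuous fun x => |f x| ^ p := fun hf => continuous_norm_rpow hp hf
  obtain ⟨C, hC, h⟩ := homog_bound (G := ℝ × ℝ) hp
    (fun x => |(|x.1| ^ p - |x.2| ^ p)| - δ * |x.1| ^ p) (fun x => |x.1 - x.2| ^ p)
    ((((hc (by fun_prop)).sub (hc (by fun_prop))).abs).sub
      (continuous_const.mul (hc (by fun_prop))))
    (hc (by fun_prop))
    (fun t ht x => by
      simp only [Prod.smul_fst, Prod.smul_snd, smul_eq_mul, abs_mul, abs_of_nonneg ht,
        Real.mul_rpow ht (abs_nonneg _), ← mul_sub, abs_of_nonneg (Real.rpow_nonneg ht p)]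
      ring)
    (fun t ht x => by
      simp only [Prod.smul_fst, Prod.smul_snd, smul_eq_mul, abs_mul, abs_of_nonneg ht,
        Real.mul_rpow ht (abs_nonneg _), ← mul_sub])
    (fun x => by positivity)
    (fun x hx h => by
      apply Real.rpow_pos_of_pos
      rw [abs_pos, sub_ne_zero]
      intro h1
      rw [h1, sub_self, abs_zero] at h
      have h2 : |x.2| ^ p ≤ 0 := by nlinarith
      have h3 : x.2 = 0 := by
        by_contra h4
        have := Real.rpow_pos_of_pos (abs_pos.2 h4) p
        linarith
      exact hx (Prod.ext (h1.trans h3) h3))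
  exact ⟨C, hC, fun a b => by have := h (a, b); simp only at this; linarith⟩

lemma norm_rpow_convex {G : Type*} [NormedAddCommGroup G] [NormedSpace ℝ G]
    {p : ℝ} (hp : 1 < p) {η : ℝ} (h0 : 0 ≤ η) (h1 : η ≤ 1) (a b : G) :
    ‖(1 - η) • a + η • b‖ ^ p ≤ (1 - η) * ‖a‖ ^ p + η * ‖b‖ ^ p := by
  have h2 : ‖(1 - η) • a + η • b‖ ≤ (1 - η) * ‖a‖ + η * ‖b‖ := by
    refine (norm_add_le _ _).trans ?_
    rw [norm_smul, norm_smul, Real.norm_of_nonneg h0, Real.norm_of_nonneg (by linarith)]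
  refine (Real.rpow_le_rpow (norm_nonneg _) h2 (by linarith)).trans ?_
  have := (convexOn_rpow hp.le).2 (norm_nonneg a) (norm_nonneg b) (by linarith : 0 ≤ 1 - η) h0
    (by ring)
  simpa [smul_eq_mul] using this

lemma abs_le_eps {p ε : ℝ} (hp : 1 < p) (hε : 0 < ε) {x : ℝ} (hx : 0 ≤ x) :
    x ≤ ε + ε ^ (1 - p) * x ^ p := by
  have h0 : 0 ≤ ε ^ (1 - p) * x ^ p := by positivity
  by_cases h : x ≤ ε
  · linarith
  · have hx' : 0 < x := by linarith
    have h1 : x = x ^ (1 - p) * x ^ p := by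
      rw [← Real.rpow_add hx']; simp
    have h2 : x ^ (1 - p) ≤ ε ^ (1 - p) :=
      Real.rpow_le_rpow_of_nonpos hε (by linarith) (by linarith)
    have h3 : x ^ (1 - p) * x ^ p ≤ ε ^ (1 - p) * x ^ p := by gcongr
    linarith

def C1c {d : ℕ} (Ω : Set (Ed d)) (u : Ed d → ℝ) : Prop :=
  ContDiff ℝ 1 u ∧ HasCompactSupport u ∧ tsupport u ⊆ Ω

lemma IsTestOn.c1c {d : ℕ} {Ω : Set (Ed d)} {u : Ed d → ℝ} (h : IsTestOn Ω u) : C1c Ω u :=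
  ⟨h.1.of_le (by exact_mod_cast le_top), h.2.1, h.2.2⟩

section grad
variable {d : ℕ} {f g : Ed d → ℝ} {x : Ed d}

lemma grad_hasFDeriv {f' : Ed d →L[ℝ] ℝ} (h : HasFDerivAt f f' x) :
    gradient f x = (InnerProductSpace.toDual ℝ (Ed d)).symm f' := by
  rw [gradient, h.fderiv]

lemma norm_grad : ‖gradient f x‖ = ‖fderiv ℝ f x‖ := by
  rw [gradient, LinearIsometryEquiv.norm_map]

lemma grad_add (hf : DifferentiableAt ℝ f x) (hg : DifferentiableAt ℝ g x) :
    gradient (fun y => f y + g y) x = gradient f x + gradient g x := by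
  refine (grad_hasFDeriv (hf.hasFDerivAt.add hg.hasFDerivAt)).trans ?_
  rw [map_add]; rfl

lemma grad_sub (hf : DifferentiableAt ℝ f x) (hg : DifferentiableAt ℝ g x) :
    gradient (fun y => f y - g y) x = gradient f x - gradient g x := by
  refine (grad_hasFDeriv (hf.hasFDerivAt.sub hg.hasFDerivAt)).trans ?_
  rw [map_sub]; rfl

lemma grad_mul (hf : DifferentiableAt ℝ f x) (hg : DifferentiableAt ℝ g x) :
    gradient (fun y => f y * g y) x = f x • gradient g x + g x • gradient f x := by
  refine (grad_hasFDeriv (hf.hasFDerivAt.mul hg.hasFDerivAt)).trans ?_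
  rw [map_add, map_smul, map_smul]; rfl

lemma grad_const_mul (c : ℝ) (hf : DifferentiableAt ℝ f x) :
    gradient (fun y => c * f y) x = c • gradient f x := by
  rw [grad_hasFDeriv (hf.hasFDerivAt.const_mul c), map_smul]; rfl

lemma grad_abs_rpow {p : ℝ} (hp : 1 < p) (hf : DifferentiableAt ℝ f x) :
    gradient (fun y => |f y| ^ p) x = (p * |f x| ^ (p - 2) * f x) • gradient f x := by
  refine (grad_hasFDeriv ((hasDerivAt_abs_rpow (f x) hp).comp_hasFDerivAt x hf.hasFDerivAt)).trans ?_
  rw [map_smul]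
  rfl

lemma continuous_grad (hf : ContDiff ℝ 1 f) : Continuous (gradient f) := by
  unfold gradient
  exact (InnerProductSpace.toDual ℝ (Ed d)).symm.continuous.comp (hf.continuous_fderiv (by simp))

lemma grad_eq_zero (hx : x ∉ tsupport f) : gradient f x = 0 := by
  rw [gradient, fderiv_of_notMem_tsupport ℝ hx, map_zero]

lemma contDiff_abs_rpow {p : ℝ} (hp : 1 < p) (hf : ContDiff ℝ 1 f) :
    ContDiff ℝ 1 (fun y => |f y| ^ p) := by
  simpa using hf.norm_rpow hp

lemma inner_grad (v : Ed d) : ⟪v, gradient f x⟫ = fderiv ℝ f x v := by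
  rw [real_inner_comm, inner_gradient_left]

end grad

lemma continuous_abs_rpow {X : Type*} [TopologicalSpace X] {p : ℝ}
    (hp : 1 < p) {f : X → ℝ} (hf : Continuous f) : Continuous (fun x => |f x| ^ p) :=
  continuous_norm_rpow hp hf

section integ
variable {d : ℕ} {Ω : Set (Ed d)} {V : Ed d → ℝ} {p : ℝ}

lemma integrable_of_K {g : Ed d → ℝ} (hg : Continuous g) {K : Set (Ed d)} (hK : IsCompact K)
    (h0 : ∀ x, x ∉ K → g x = 0) : Integrable g :=
  hg.integrable_of_hasCompactSupport (HasCompactSupport.intro hK h0)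

lemma integrable_V {g : Ed d → ℝ} (hV : LocBddOn Ω V) (hg : Continuous g) {K : Set (Ed d)}
    (hK : IsCompact K) (hKΩ : K ⊆ Ω) (h0 : ∀ x, x ∉ K → g x = 0) :
    Integrable (fun x => V x * g x) := by
  obtain ⟨M, hM⟩ := hV.2 K hK hKΩ
  refine Integrable.mono' (g := fun x => M * |g x|) ((integrable_of_K hg hK h0).abs.const_mul M)
    (hV.1.mul hg.measurable).aestronglyMeasurable ?_
  filter_upwards [hM] with x hx
  by_cases h : x ∈ K
  · rw [Real.norm_eq_abs, abs_mul]
    exact mul_le_mul_of_nonneg_right (hx h) (abs_nonneg _)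
  · simp [h0 x h]

lemma zero_rpow' (hp : 1 < p) : (0 : ℝ) ^ p = 0 := Real.zero_rpow (by linarith)

lemma absp_zero (hp : 1 < p) {u : Ed d → ℝ} {x : Ed d} (hx : x ∉ tsupport u) : |u x| ^ p = 0 := by
  rw [image_eq_zero_of_notMem_tsupport hx, abs_zero, zero_rpow' hp]

lemma gradp_zero (hp : 1 < p) {u : Ed d → ℝ} {x : Ed d} (hx : x ∉ tsupport u) :
    ‖gradient u x‖ ^ p = 0 := by
  rw [grad_eq_zero hx, norm_zero, zero_rpow' hp]

lemma integrable_grad (hp : 1 < p) {u : Ed d → ℝ} (hu : C1c Ω u) :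
    Integrable (fun x => ‖gradient u x‖ ^ p) :=
  integrable_of_K (continuous_norm_rpow hp (continuous_grad hu.1)) hu.2.1
    (fun _ hx => gradp_zero hp hx)

lemma integrable_absp (hp : 1 < p) {u : Ed d → ℝ} (hu : C1c Ω u) :
    Integrable (fun x => |u x| ^ p) :=
  integrable_of_K (continuous_abs_rpow hp hu.1.continuous) hu.2.1
    (fun _ hx => absp_zero hp hx)

lemma integrable_Vabsp (hp : 1 < p) (hV : LocBddOn Ω V) {u : Ed d → ℝ} (hu : C1c Ω u) :
    Integrable (fun x => V x * |u x| ^ p) :=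
  integrable_V hV (continuous_abs_rpow hp hu.1.continuous) hu.2.1 hu.2.2
    (fun _ hx => absp_zero hp hx)

def Qf (p : ℝ) (V u : Ed d → ℝ) : ℝ := ∫ x, (‖gradient u x‖ ^ p + V x * |u x| ^ p)

lemma Qp_eq (hp : 1 < p) {u : Ed d → ℝ} (hu : tsupport u ⊆ Ω) (V : Ed d → ℝ) :
    Qp p Ω V u = Qf p V u := by
  unfold Qp Qf
  apply setIntegral_eq_integral_of_forall_compl_eq_zero
  intro x hx
  have : x ∉ tsupport u := fun h => hx (hu h)
  rw [gradp_zero hp this, absp_zero hp this]; simp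

lemma Qf_eq (hp : 1 < p) (hV : LocBddOn Ω V) {u : Ed d → ℝ} (hu : C1c Ω u) :
    Qf p V u = (∫ x, ‖gradient u x‖ ^ p) + ∫ x, V x * |u x| ^ p :=
  integral_add (integrable_grad hp hu) (integrable_Vabsp hp hV hu)

end integ

section moll
variable {d : ℕ}

lemma C1c_bdd {F : Type*} [NormedAddCommGroup F] {g : Ed d → F} (hg : Continuous g)
    (hc : HasCompactSupport g) : ∃ C : ℝ, 0 ≤ C ∧ ∀ x, ‖g x‖ ≤ C := by
  obtain ⟨C, hC⟩ := hg.bounded_above_of_compact_support hc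
  exact ⟨C, (norm_nonneg _).trans (hC 0), hC⟩

open ContinuousLinearMap in
lemma moll_exists {F : Type*} [NormedAddCommGroup F] [NormedSpace ℝ F] [CompleteSpace F]
    {g : Ed d → F} (hg : Continuous g) (hc : HasCompactSupport g) {ε : ℝ} (hε : 0 < ε) :
    ∃ r > 0, ∀ φ : ContDiffBump (0 : Ed d), φ.rOut ≤ r → ∀ x,
      ‖(convolution (φ.normed volume) g (lsmul ℝ ℝ) volume) x - g x‖ ≤ ε := by
  have hu := hc.uniformContinuous_of_continuous hg
  rw [Metric.uniformContinuous_iff] at hu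
  obtain ⟨r, hr, h⟩ := hu ε hε
  refine ⟨r, hr, fun φ hφ x => ?_⟩
  rw [← dist_eq_norm]
  apply ContDiffBump.dist_normed_convolution_le hg.aestronglyMeasurable
  intro y hy
  exact (h (lt_of_lt_of_le (Metric.mem_ball.1 hy) hφ)).le

open ContinuousLinearMap in
/-- smooth approximation of continuous vector fields -/
lemma approx_cont {F : Type*} [NormedAddCommGroup F] [NormedSpace ℝ F] [CompleteSpace F]
    {g : Ed d → F} (hg : Continuous g) (hc : HasCompactSupport g) {ε : ℝ} (hε : 0 < ε) :
    ∃ P : Ed d → F, ContDiff ℝ 1 P ∧ ∀ x, ‖P x - g x‖ ≤ ε := by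
  obtain ⟨r, hr, h⟩ := moll_exists hg hc hε
  let φ : ContDiffBump (0 : Ed d) := ⟨r / 2, r, by linarith, by linarith⟩
  refine ⟨_, ?_, h φ le_rfl⟩
  exact φ.hasCompactSupport_normed.contDiff_convolution_left _ (φ.contDiff_normed)
    hg.locallyIntegrable

open ContinuousLinearMap in
lemma approx_C1 {Ω : Set (Ed d)} (hΩ : IsOpen Ω) {f : Ed d → ℝ} (hf : C1c Ω f) :
    ∃ K : Set (Ed d), IsCompact K ∧ K ⊆ Ω ∧ tsupport f ⊆ K ∧ ∀ ε > 0, ∃ g : Ed d → ℝ,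
      IsTestOn Ω g ∧ tsupport g ⊆ K ∧ ∀ x, |g x - f x| ≤ ε ∧
        ‖gradient g x - gradient f x‖ ≤ ε := by
  obtain ⟨h1, h2, h3⟩ := hf
  obtain ⟨δ, hδ, hδΩ⟩ := h2.isCompact.exists_cthickening_subset_open hΩ h3
  have hKc : IsCompact (Metric.cthickening δ (tsupport f)) := h2.isCompact.cthickening
  refine ⟨_, hKc, hδΩ, Metric.self_subset_cthickening _, fun ε hε => ?_⟩
  obtain ⟨r1, hr1, H1⟩ := moll_exists h1.continuous h2 hε
  obtain ⟨r2, hr2, H2⟩ := moll_exists (h1.continuous_fderiv (by simp)) (h2.fderiv ℝ) hε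
  set r := min δ (min r1 r2) with hr
  have hr0 : 0 < r := by positivity
  let φ : ContDiffBump (0 : Ed d) := ⟨r / 2, r, by linarith, by linarith⟩
  have hφ : φ.rOut = r := rfl
  set g := convolution (φ.normed volume) f (lsmul ℝ ℝ) volume with hgdef
  have hsupp : Function.support g ⊆ Metric.cthickening δ (tsupport f) := by
    refine (support_convolution_subset _).trans ?_
    rintro _ ⟨a, ha, b, hb, rfl⟩
    rw [φ.support_normed_eq, mem_ball_zero_iff, hφ] at ha
    apply Metric.mem_cthickening_of_dist_le _ b _ _ (subset_tsupport _ hb)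
    rw [dist_eq_norm]
    simp only [add_sub_cancel_right]
    exact ha.le.trans (min_le_left _ _)
  have htsupp : tsupport g ⊆ Metric.cthickening δ (tsupport f) :=
    closure_minimal hsupp Metric.isClosed_cthickening
  have hgc : HasCompactSupport g := hKc.of_isClosed_subset (isClosed_tsupport _) htsupp
  refine ⟨g, ⟨?_, hgc, htsupp.trans hδΩ⟩, htsupp, fun x => ⟨?_, ?_⟩⟩
  · exact φ.hasCompactSupport_normed.contDiff_convolution_left _ (φ.contDiff_normed)
      h1.continuous.locallyIntegrable
  · exact H1 φ (by rw [hφ]; exact (min_le_right _ _).trans (min_le_left _ _)) x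
  · have hd := h2.hasFDerivAt_convolution_right (lsmul ℝ ℝ) (μ := volume) (f := φ.normed volume)
      φ.continuous_normed.locallyIntegrable h1 x
    have h5 := H2 φ (by rw [hφ]; exact (min_le_right _ _).trans (min_le_right _ _)) x
    rw [gradient, gradient, ← map_sub, LinearIsometryEquiv.norm_map, hd.fderiv]
    have e : convolution (φ.normed volume) (fderiv ℝ f) (precompR (Ed d) (lsmul ℝ ℝ)) volume x =
        convolution (φ.normed volume) (fderiv ℝ f) (lsmul ℝ ℝ) volume x := by
      unfold convolution
      congr 1
    rw [e]; exact h5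

end moll

section core
variable {d : ℕ} {Ω : Set (Ed d)} {V : Ed d → ℝ} {p : ℝ}

lemma nonneg_C1 (hp : 1 < p) (hΩ : IsOpen Ω) (hV : LocBddOn Ω V) (hn : NonnegOn p Ω V)
    {f : Ed d → ℝ} (hf : C1c Ω f) : 0 ≤ Qf p V f := by
  obtain ⟨K, hK, hKΩ, hfK, H⟩ := approx_C1 hΩ hf
  obtain ⟨M, hM⟩ := hV.2 K hK hKΩ
  obtain ⟨B0, hB0, hB0'⟩ := C1c_bdd hf.1.continuous hf.2.1
  obtain ⟨B1, hB1, hB1'⟩ := C1c_bdd (continuous_grad hf.1)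
    (HasCompactSupport.intro hf.2.1 (fun x hx => grad_eq_zero hx))
  choose g hg hgK hgc using fun k : ℕ => H (1 / ((k : ℝ) + 1)) (by positivity)
  have hε : Tendsto (fun k : ℕ => 1 / ((k : ℝ) + 1)) atTop (𝓝 0) :=
    tendsto_one_div_add_atTop_nhds_zero_nat
  have hε1 : ∀ k : ℕ, 1 / ((k : ℝ) + 1) ≤ 1 := fun k => by
    rw [div_le_one (by positivity)]; linarith [(Nat.cast_nonneg k : (0:ℝ) ≤ k)]
  have lim : Tendsto (fun k => Qf p V (g k)) atTop (𝓝 (Qf p V f)) := by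
    unfold Qf
    refine tendsto_integral_of_dominated_convergence
      (K.indicator (fun _ => (B1 + 1) ^ p + M * (B0 + 1) ^ p)) ?_ ?_ ?_ ?_
    · intro k
      exact ((continuous_norm_rpow hp (continuous_grad (hg k).c1c.1)).aestronglyMeasurable).add
        ((hV.1.mul (continuous_abs_rpow hp
          (hg k).c1c.1.continuous).measurable).aestronglyMeasurable)
    · exact (integrable_indicator_iff hK.measurableSet).2 (integrableOn_const hK.measure_lt_top.ne)
    · intro k
      filter_upwards [hM] with x hx
      by_cases hxK : x ∈ K
      · rw [Set.indicator_of_mem hxK]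
        have h1 : ‖gradient (g k) x‖ ≤ B1 + 1 := by
          have := norm_add_le (gradient (g k) x - gradient f x) (gradient f x)
          rw [sub_add_cancel] at this
          linarith [(hgc k x).2, hB1' x, hε1 k]
        have h2 : |g k x| ≤ B0 + 1 := by
          have := abs_add_le (g k x - f x) (f x)
          rw [sub_add_cancel] at this
          have h3 := hB0' x
          rw [Real.norm_eq_abs] at h3
          linarith [(hgc k x).1, hε1 k]
        refine (norm_add_le _ _).trans ?_
        rw [Real.norm_of_nonneg (by positivity), norm_mul, Real.norm_eq_abs,
          Real.norm_of_nonneg (by positivity : 0 ≤ |g k x| ^ p)]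
        have hM0 : 0 ≤ M := (abs_nonneg _).trans (hx hxK)
        have h4 := Real.rpow_le_rpow (norm_nonneg _) h1 (by linarith : 0 ≤ p)
        have h5 := Real.rpow_le_rpow (abs_nonneg _) h2 (by linarith : 0 ≤ p)
        have h6 := mul_le_mul (hx hxK) h5 (by positivity) hM0
        linarith
      · have : x ∉ tsupport (g k) := fun h => hxK (hgK k h)
        rw [gradp_zero hp this, absp_zero hp this, Set.indicator_of_notMem hxK]; simp
    · refine Eventually.of_forall (fun x => ?_)
      have h1 : Tendsto (fun k => gradient (g k) x) atTop (𝓝 (gradient f x)) := by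
        rw [tendsto_iff_norm_sub_tendsto_zero]
        exact squeeze_zero (fun _ => norm_nonneg _) (fun k => (hgc k x).2) hε
      have h2 : Tendsto (fun k => g k x) atTop (𝓝 (f x)) := by
        rw [tendsto_iff_norm_sub_tendsto_zero]
        exact squeeze_zero (fun _ => norm_nonneg _) (fun k => (hgc k x).1) hε
      exact (h1.norm.rpow_const (Or.inr (by linarith))).add
        ((h2.abs.rpow_const (Or.inr (by linarith))).const_mul _)
  exact ge_of_tendsto' lim (fun k => by
    rw [← Qp_eq hp (hg k).2.2]; exact hn _ (hg k))

lemma ibp {Y : Ed d → Ed d} (hY : ContDiff ℝ 1 Y) (hc : HasCompactSupport Y) :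
    ∃ g : Ed d → ℝ, Continuous g ∧ (∀ x, x ∉ tsupport Y → g x = 0) ∧
      ∀ f : Ed d → ℝ, ContDiff ℝ 1 f → HasCompactSupport f →
        ∫ x, ⟪Y x, gradient f x⟫ = - ∫ x, g x * f x := by
  let b := EuclideanSpace.basisFun (Fin d) ℝ
  let Yi : Fin d → Ed d → ℝ := fun i x => ⟪b i, Y x⟫
  have hYi : ∀ i, ContDiff ℝ 1 (Yi i) := fun i => contDiff_const.inner ℝ hY
  have hYi0 : ∀ i x, x ∉ tsupport Y → Yi i x = 0 := fun i x hx => by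
    simp only [Yi]; rw [image_eq_zero_of_notMem_tsupport hx, inner_zero_right]
  have hYs : ∀ i, tsupport (Yi i) ⊆ tsupport Y := fun i =>
    closure_minimal (fun x hx => by_contra fun h => hx (hYi0 i x h)) (isClosed_tsupport _)
  have hd0 : ∀ i x, x ∉ tsupport Y → fderiv ℝ (Yi i) x = 0 := fun i x hx =>
    fderiv_of_notMem_tsupport ℝ (fun h => hx (hYs i h))
  have hcd : ∀ i, Continuous (fun x => fderiv ℝ (Yi i) x (b i)) := fun i =>
    ((hYi i).continuous_fderiv (by simp)).clm_apply continuous_const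
  refine ⟨fun x => ∑ i, fderiv ℝ (Yi i) x (b i), ?_, ?_, ?_⟩
  · exact continuous_finset_sum _ (fun i _ => hcd i)
  · intro x hx
    exact Finset.sum_eq_zero (fun i _ => by rw [hd0 i x hx]; simp)
  · intro f hf hfc
    have hfd : ∀ i, Continuous (fun x => fderiv ℝ f x (b i)) := fun i =>
      (hf.continuous_fderiv (by simp)).clm_apply continuous_const
    have e1 : ∀ x, ⟪Y x, gradient f x⟫ = ∑ i, Yi i x * fderiv ℝ f x (b i) := by
      intro x
      rw [inner_grad]
      conv_lhs => rw [← b.sum_repr' (Y x)]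
      rw [map_sum]
      simp [Yi]
    have i1 : ∀ i, Integrable (fun x => fderiv ℝ (Yi i) x (b i) * f x) := fun i =>
      integrable_of_K ((hcd i).mul hf.continuous) hc.isCompact
        (fun x hx => by rw [hd0 i x hx]; simp)
    have i2 : ∀ i, Integrable (fun x => Yi i x * fderiv ℝ f x (b i)) := fun i =>
      integrable_of_K ((hYi i).continuous.mul (hfd i)) hc.isCompact
        (fun x hx => by rw [hYi0 i x hx]; simp)
    have i3 : ∀ i, Integrable (fun x => Yi i x * f x) := fun i =>
      integrable_of_K ((hYi i).continuous.mul hf.continuous) hc.isCompact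
        (fun x hx => by rw [hYi0 i x hx]; simp)
    simp_rw [e1, Finset.sum_mul]
    rw [integral_finset_sum _ (fun i _ => i2 i), integral_finset_sum _ (fun i _ => i1 i),
      ← Finset.sum_neg_distrib]
    refine Finset.sum_congr rfl (fun i _ => ?_)
    exact integral_mul_fderiv_eq_neg_fderiv_mul_of_integrable (i1 i) (i2 i) (i3 i)
      (fun x _ => (hYi i).differentiable (by simp) x) (fun x _ => hf.differentiable (by simp) x)

/-- `∫ g (v_n - Φ) → 0` when `v_n → Φ` in `L^p(K)`. -/
lemma tendsto_weak (hp : 1 < p) {K : Set (Ed d)} (hK : IsCompact K) {v : ℕ → Ed d → ℝ}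
    {Φ g : Ed d → ℝ} (hv : ∀ n, Continuous (v n)) (hΦ : Continuous Φ) (hg : Continuous g)
    (hg0 : ∀ x, x ∉ K → g x = 0)
    (hlim : Tendsto (fun n => ∫ x in K, |v n x - Φ x| ^ p) atTop (𝓝 0)) :
    Tendsto (fun n => ∫ x, g x * (v n x - Φ x)) atTop (𝓝 0) := by
  obtain ⟨C, hC, hCg⟩ := C1c_bdd hg (HasCompactSupport.intro hK hg0)
  have hint : ∀ n, IntegrableOn (fun x => |v n x - Φ x| ^ p) K := fun n =>
    (continuous_abs_rpow hp ((hv n).sub hΦ)).continuousOn.integrableOn_compact hK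
  have bound : ∀ ε > 0, ∀ n, |∫ x, g x * (v n x - Φ x)| ≤
      C * (ε * (volume K).toReal + ε ^ (1 - p) * ∫ x in K, |v n x - Φ x| ^ p) := by
    intro ε hε n
    rw [← setIntegral_eq_integral_of_forall_compl_eq_zero (s := K)
      (fun x hx => by rw [hg0 x hx, zero_mul])]
    have hc1 : IntegrableOn (fun _ : Ed d => ε) K := integrableOn_const hK.measure_lt_top.ne
    have e : C * (ε * (volume K).toReal + ε ^ (1 - p) * ∫ x in K, |v n x - Φ x| ^ p) =
        ∫ x in K, C * (ε + ε ^ (1 - p) * |v n x - Φ x| ^ p) := by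
      rw [integral_const_mul, integral_add hc1 ((hint n).const_mul _), integral_const_mul]
      simp [Measure.real, mul_comm]
    rw [e, ← Real.norm_eq_abs]
    refine norm_integral_le_of_norm_le ((hc1.add ((hint n).const_mul _)).const_mul _) ?_
    refine Eventually.of_forall (fun x => ?_)
    rw [norm_mul, Real.norm_eq_abs (v n x - Φ x)]
    exact mul_le_mul (hCg x) (abs_le_eps hp hε (abs_nonneg _)) (abs_nonneg _) hC
  rw [Metric.tendsto_atTop']
  intro ε0 hε0
  set m := (volume K).toReal with hm
  have hm0 : 0 ≤ m := ENNReal.toReal_nonneg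
  set ε := ε0 / (2 * (C * m + 1)) with hε
  have hεp : 0 < ε := by positivity
  have h1 : Tendsto (fun n => C * (ε * m + ε ^ (1 - p) * ∫ x in K, |v n x - Φ x| ^ p)) atTop
      (𝓝 (C * (ε * m + ε ^ (1 - p) * 0))) := ((hlim.const_mul _).const_add _).const_mul _
  have h2 : C * (ε * m + ε ^ (1 - p) * 0) < ε0 := by
    have : C * (ε * m + ε ^ (1 - p) * 0) = ε0 * (C * m) / (2 * (C * m + 1)) := by
      rw [hε]; ring
    rw [this, div_lt_iff₀ (by positivity)]
    have : 0 ≤ C * m := by positivity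
    nlinarith
  have h3 := h1.eventually (gt_mem_nhds h2)
  obtain ⟨N, hN⟩ := eventually_atTop.1 h3
  refine ⟨N, fun n hn => ?_⟩
  rw [dist_zero_right, Real.norm_eq_abs]
  exact (bound ε hεp n).trans_lt (hN n hn.le)

end core

section core4
variable {d : ℕ} {Ω : Set (Ed d)} {V : Ed d → ℝ} {p : ℝ}

lemma lsc (hp : 1 < p) {η : Ed d → ℝ} (hη : ContDiff ℝ 1 η) (hηc : HasCompactSupport η)
    (hη0 : ∀ x, 0 ≤ η x) {v : ℕ → Ed d → ℝ} {Φ : Ed d → ℝ}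
    (hv : ∀ n, C1c Ω (v n)) (hΦ : C1c Ω Φ)
    (hlim : Tendsto (fun n => ∫ x in tsupport η, |v n x - Φ x| ^ p) atTop (𝓝 0))
    {ε : ℝ} (hε : 0 < ε) :
    ∀ᶠ n in atTop, (∫ x, η x * ‖gradient Φ x‖ ^ p) - ε ≤
      (1 + ε) * ∫ x, η x * ‖gradient (v n) x‖ ^ p := by
  have hp0 : 0 < p := by linarith
  have hgΦ := continuous_grad hΦ.1
  set D := ∫ x, η x * (1 + ‖gradient Φ x‖) with hD
  have hD0 : 0 ≤ D := integral_nonneg (fun x => mul_nonneg (hη0 x) (by positivity))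
  set e := ε / (2 * p * (D + 1)) with he
  have he0 : 0 < e := by positivity
  have he1 : p * e ≤ ε := by
    rw [he, mul_div_assoc', div_le_iff₀ (by positivity)]; nlinarith [mul_nonneg (mul_pos hp0 hε).le hD0, mul_pos hp0 hε]
  have he2 : p * e * D ≤ ε / 2 := by
    rw [he]
    have : p * (ε / (2 * p * (D + 1))) * D = (ε / 2) * (D / (D + 1)) := by field_simp
    rw [this]
    have : D / (D + 1) ≤ 1 := by rw [div_le_one (by positivity)]; linarith
    nlinarith
  obtain ⟨P, hP, hPe⟩ := approx_cont ((continuous_FF hp).comp hgΦ)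
    (HasCompactSupport.intro hΦ.2.1 (fun x hx => by
      simp only [Function.comp]; rw [grad_eq_zero hx, FF_zero])) he0
  have hsup : tsupport (fun x => η x • P x) ⊆ tsupport η :=
    closure_mono (fun x hx h => hx (by simp only; rw [h, zero_smul]))
  have hYc : HasCompactSupport (fun x => η x • P x) :=
    hηc.of_isClosed_subset (isClosed_tsupport _) hsup
  obtain ⟨g, hg, hg0, hgI⟩ := ibp (hη.smul hP) hYc
  have hw := tendsto_weak hp hηc (fun n => (hv n).1.continuous) hΦ.1.continuous hg
    (fun x hx => hg0 x (fun h => hx (hsup h))) hlim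
  have hev := (hw.const_mul p).eventually_lt_const (show p * 0 < ε / 2 by simpa using by positivity)
  filter_upwards [hev] with n hn
  have hgv := continuous_grad (hv n).1
  have key := hgI (fun x => v n x - Φ x) ((hv n).1.sub hΦ.1) ((hv n).2.1.sub hΦ.2.1)
  have hη0' : ∀ x, x ∉ tsupport η → η x = 0 := fun x hx => image_eq_zero_of_notMem_tsupport hx
  have i1 : Integrable (fun x => η x * ‖gradient Φ x‖ ^ p) :=
    integrable_of_K (hη.continuous.mul (continuous_norm_rpow hp hgΦ)) hηc
      (fun x hx => by rw [hη0' x hx, zero_mul])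
  have i2 : Integrable (fun x => η x * ‖gradient (v n) x‖ ^ p) :=
    integrable_of_K (hη.continuous.mul (continuous_norm_rpow hp hgv)) hηc
      (fun x hx => by rw [hη0' x hx, zero_mul])
  have i3 : Integrable (fun x => η x * (1 + ‖gradient Φ x‖)) :=
    integrable_of_K (hη.continuous.mul (continuous_const.add hgΦ.norm)) hηc
      (fun x hx => by rw [hη0' x hx, zero_mul])
  have i4 : Integrable (fun x => ⟪η x • P x, gradient (fun x => v n x - Φ x) x⟫) :=
    integrable_of_K ((hη.continuous.smul hP.continuous).inner
      (continuous_grad ((hv n).1.sub hΦ.1))) hηc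
      (fun x hx => by rw [hη0' x hx, zero_smul, inner_zero_left])
  have pt : ∀ x, η x * ‖gradient Φ x‖ ^ p + p * ⟪η x • P x, gradient (fun x => v n x - Φ x) x⟫
      - p * e * (η x * (1 + ‖gradient Φ x‖)) ≤ (1 + p * e) * (η x * ‖gradient (v n) x‖ ^ p) := by
    intro x
    rw [grad_sub ((hv n).1.differentiable one_ne_zero x) (hΦ.1.differentiable one_ne_zero x),
      real_inner_smul_left]
    have h1 := breg_nonneg hp (gradient (v n) x) (gradient Φ x)
    unfold Breg at h1
    set A := gradient (v n) x
    set B := gradient Φ x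
    have h2 : ⟪P x, A - B⟫ ≤ ⟪FF p B, A - B⟫ + e * (1 + ‖A‖ ^ p + ‖B‖) := by
      have h3 : ⟪P x - FF p B, A - B⟫ ≤ e * (1 + ‖A‖ ^ p + ‖B‖) := by
        refine (real_inner_le_norm _ _).trans ?_
        refine mul_le_mul (hPe x) ?_ (norm_nonneg _) he0.le
        refine (norm_sub_le _ _).trans ?_
        have := abs_le_eps hp one_pos (norm_nonneg A)
        rw [Real.one_rpow] at this
        linarith
      rw [inner_sub_left] at h3; linarith
    have h4 : 0 ≤ ‖A‖ ^ p - ‖B‖ ^ p - p * (⟪P x, A - B⟫ - e * (1 + ‖A‖ ^ p + ‖B‖)) := by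
      have := mul_le_mul_of_nonneg_left h2 hp0.le
      nlinarith
    have h5 := mul_nonneg (hη0 x) h4
    nlinarith
  have hint := integral_mono ((i1.add (i4.const_mul p)).sub (i3.const_mul (p * e)))
    (i2.const_mul (1 + p * e)) pt
  rw [integral_sub' (i1.add (i4.const_mul p)) (i3.const_mul _), integral_add' i1 (i4.const_mul p),
    integral_const_mul, integral_const_mul, integral_const_mul] at hint
  simp only [Pi.smul_apply'] at key
  rw [key] at hint
  have h6 : 0 ≤ ∫ x, η x * ‖gradient (v n) x‖ ^ p :=
    integral_nonneg (fun x => mul_nonneg (hη0 x) (by positivity))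
  have h7 := mul_le_mul_of_nonneg_right he1 h6
  rw [← hD] at hint
  nlinarith

lemma grad_interp (hp : 1 < p) {δ C C0 η q : ℝ} {a A G g : Ed d} (hC : 0 < C)
    (hδC : ∀ A X : Ed d, ‖A + X‖ ^ p ≤ (1 + δ) * ‖A‖ ^ p + C * ‖X‖ ^ p)
    (h0 : 0 ≤ η) (h1 : η ≤ 1) (hg : ‖g‖ ^ p ≤ C0 * η ^ (p - 1)) (hδ : 0 < δ)
    (hC0 : 0 ≤ C0)
    (hG : G = (1 - η) • a + η • A + q • g) :
    ‖G‖ ^ p ≤ (1 - η) * ‖a‖ ^ p + (1 + δ) * (η * ‖A‖ ^ p) + C * C0 * |q| ^ p := by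
  rcases h0.eq_or_lt with h | h
  · have hg0 : g = 0 := by
      rw [← h, Real.zero_rpow (by linarith), mul_zero] at hg
      have := (Real.rpow_eq_zero (norm_nonneg g) (by linarith : p ≠ 0)).1
        (le_antisymm hg (by positivity))
      simpa using this
    rw [hG, hg0, ← h]
    simp
    positivity
  · have e1 : G = (1 - η) • a + η • (A + (η⁻¹ * q) • g) := by
      rw [hG, smul_add, smul_smul, ← mul_assoc, mul_inv_cancel₀ h.ne', one_mul, add_assoc]
    rw [e1]
    refine (norm_rpow_convex hp h0 h1 _ _).trans ?_
    have h2 := mul_le_mul_of_nonneg_left (hδC A ((η⁻¹ * q) • g)) h0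
    have h3 : η * ‖(η⁻¹ * q) • g‖ ^ p ≤ C0 * |q| ^ p := by
      rw [norm_smul, Real.mul_rpow (norm_nonneg _) (norm_nonneg _), norm_mul, norm_inv,
        Real.norm_of_nonneg h0, Real.mul_rpow (by positivity) (norm_nonneg _), Real.norm_eq_abs,
        Real.inv_rpow h0]
      have h4 : η ^ (p - 1) * η = η ^ p := rpow_sub_one_mul' h0 hp
      have h5 : 0 < η ^ p := by positivity
      calc η * ((η ^ p)⁻¹ * |q| ^ p * ‖g‖ ^ p)
          ≤ η * ((η ^ p)⁻¹ * |q| ^ p * (C0 * η ^ (p - 1))) := by gcongr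
        _ = (η ^ (p - 1) * η) * (η ^ p)⁻¹ * (C0 * |q| ^ p) := by ring
        _ = C0 * |q| ^ p := by rw [h4, mul_inv_cancel₀ h5.ne', one_mul]
    have h6 := mul_le_mul_of_nonneg_left h3 hC.le
    nlinarith

lemma core_min (hp : 1 < p) (hΩ : IsOpen Ω) (hV : LocBddOn Ω V) (hn : NonnegOn p Ω V)
    {η : Ed d → ℝ} (hη : C1c Ω η) (hη0 : ∀ x, 0 ≤ η x) (hη1 : ∀ x, η x ≤ 1) {C0 : ℝ}
    (hC0 : 0 ≤ C0) (hηg : ∀ x, ‖gradient η x‖ ^ p ≤ C0 * η x ^ (p - 1))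
    {v : ℕ → Ed d → ℝ} {Φ ψ : Ed d → ℝ}
    (hv : ∀ n, C1c Ω (v n)) (hΦ : C1c Ω Φ) (hψ : C1c Ω ψ) (hψη : ∀ x ∈ tsupport ψ, η x = 1)
    (hlim : Tendsto (fun n => ∫ x in tsupport η, |v n x - Φ x| ^ p) atTop (𝓝 0))
    (hQ : Tendsto (fun n => Qf p V (v n)) atTop (𝓝 0)) :
    (∫ x, η x * ‖gradient Φ x‖ ^ p) ≤ (∫ x, η x * ‖gradient Φ x + gradient ψ x‖ ^ p) +
      ∫ x, V x * (|Φ x + ψ x| ^ p - |Φ x| ^ p) := by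
  have hp0 : 0 < p := by linarith
  have hK : IsCompact (tsupport η) := hη.2.1
  obtain ⟨M', hM'⟩ := hV.2 _ hK hη.2.2
  set M := max M' 0
  have hM0 : 0 ≤ M := le_max_right _ _
  have hM : ∀ᵐ x ∂(volume : Measure (Ed d)), x ∈ tsupport η → |V x| ≤ M := by
    filter_upwards [hM'] with x hx h using (hx h).trans (le_max_left _ _)
  have hψK : tsupport ψ ⊆ tsupport η := fun x hx => by
    by_contra h
    have := hψη x hx
    rw [image_eq_zero_of_notMem_tsupport h] at this
    exact zero_ne_one this
  have hη0' : ∀ x, x ∉ tsupport η → η x = 0 := fun x hx => image_eq_zero_of_notMem_tsupport hx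
  have hψ0' : ∀ x, x ∉ tsupport η → ψ x = 0 := fun x hx =>
    image_eq_zero_of_notMem_tsupport (fun h => hx (hψK h))
  have cΦ := hΦ.1.continuous
  have cψ := hψ.1.continuous
  have cη := hη.1.continuous
  have hgΦ := continuous_grad hΦ.1
  have hgψ := continuous_grad hψ.1
  set I0 := ∫ x, η x * ‖gradient Φ x‖ ^ p
  set J := ∫ x, η x * ‖gradient Φ x + gradient ψ x‖ ^ p
  set R := ∫ x, V x * (|Φ x + ψ x| ^ p - |Φ x| ^ p)
  set S := ∫ x in tsupport η, (|Φ x + ψ x| ^ p + |Φ x| ^ p)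
  have main : ∀ δ > 0, I0 - δ ≤ (1 + δ) * ((1 + δ) * J + R + M * δ * S) := by
    intro δ hδ
    obtain ⟨C, hC, hCb⟩ := add_rpow_bound (G := Ed d) hp hδ
    obtain ⟨C', hC', hCb'⟩ := abs_rpow_diff hp hδ
    have step : ∀ n, (∫ x, η x * ‖gradient (v n) x‖ ^ p) ≤ Qf p V (v n) + (1 + δ) * J + R +
        (C * C0 + M * (2 * C')) * (∫ x in tsupport η, |v n x - Φ x| ^ p) + M * δ * S := by
      intro n
      have cv := (hv n).1.continuous
      have hgv := continuous_grad (hv n).1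
      set z : Ed d → ℝ := fun x => (v n x + η x * (Φ x - v n x)) + ψ x with hz
      have hzC : ContDiff ℝ 1 z := ((hv n).1.add (hη.1.mul (hΦ.1.sub (hv n).1))).add hψ.1
      have hzs : tsupport z ⊆ tsupport (v n) ∪ tsupport η := by
        refine closure_minimal ?_ ((isClosed_tsupport _).union (isClosed_tsupport _))
        intro x hx
        by_contra h
        rw [Set.mem_union, not_or] at h
        apply hx
        simp only [hz]
        rw [image_eq_zero_of_notMem_tsupport h.1, hη0' x h.2, hψ0' x h.2]; ring
      have hzc : C1c Ω z := ⟨hzC, ((hv n).2.1.isCompact.union hK).of_isClosed_subset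
        (isClosed_tsupport _) hzs, hzs.trans (Set.union_subset (hv n).2.2 hη.2.2)⟩
      have hz0 := nonneg_C1 hp hΩ hV hn hzc
      have gz : ∀ x, gradient z x = (1 - η x) • gradient (v n) x +
          η x • (gradient Φ x + gradient ψ x) + (Φ x - v n x) • gradient η x := by
        intro x
        have d1 := (hv n).1.differentiable one_ne_zero x
        have d2 := hΦ.1.differentiable one_ne_zero x
        have d3 := hη.1.differentiable one_ne_zero x
        have d4 := hψ.1.differentiable one_ne_zero x
        have d5 : DifferentiableAt ℝ (fun x => Φ x - v n x) x := d2.sub d1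
        have d6 : DifferentiableAt ℝ (fun x => η x * (Φ x - v n x)) x := d3.mul d5
        have d7 : DifferentiableAt ℝ (fun x => v n x + η x * (Φ x - v n x)) x := d1.add d6
        rw [hz, grad_add d7 d4, grad_add d1 d6, grad_mul d3 d5, grad_sub d2 d1]
        have : η x • gradient ψ x = gradient ψ x := by
          by_cases h : x ∈ tsupport ψ
          · rw [hψη x h, one_smul]
          · rw [grad_eq_zero h, smul_zero]
        rw [smul_add (η x) (gradient Φ x), this]
        module
      have i1 := integrable_grad hp (hv n)
      have i2 := integrable_Vabsp hp hV (hv n)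
      have i3 : Integrable (fun x => η x * ‖gradient (v n) x‖ ^ p) :=
        integrable_of_K (cη.mul (continuous_norm_rpow hp hgv)) hK
          (fun x hx => by rw [hη0' x hx, zero_mul])
      have i4 : Integrable (fun x => η x * ‖gradient Φ x + gradient ψ x‖ ^ p) :=
        integrable_of_K (cη.mul (continuous_norm_rpow hp (hgΦ.add hgψ))) hK
          (fun x hx => by rw [hη0' x hx, zero_mul])
      have i5 : Integrable (fun x => V x * (|Φ x + ψ x| ^ p - |Φ x| ^ p)) :=
        integrable_V hV ((continuous_abs_rpow hp (cΦ.add cψ)).sub (continuous_abs_rpow hp cΦ)) hK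
          hη.2.2 (fun x hx => by rw [hψ0' x hx]; simp)
      have i6 : Integrable ((tsupport η).indicator (fun x => |v n x - Φ x| ^ p)) :=
        (integrable_indicator_iff hK.measurableSet).2
          ((continuous_abs_rpow hp (cv.sub cΦ)).continuousOn.integrableOn_compact hK)
      have i7 : Integrable ((tsupport η).indicator (fun x => |Φ x + ψ x| ^ p + |Φ x| ^ p)) :=
        (integrable_indicator_iff hK.measurableSet).2
          (((continuous_abs_rpow hp (cΦ.add cψ)).add
            (continuous_abs_rpow hp cΦ)).continuousOn.integrableOn_compact hK)
      have pt : ∀ᵐ x ∂(volume : Measure (Ed d)), ‖gradient z x‖ ^ p + V x * |z x| ^ p ≤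
          (‖gradient (v n) x‖ ^ p + V x * |v n x| ^ p) - η x * ‖gradient (v n) x‖ ^ p +
          (1 + δ) * (η x * ‖gradient Φ x + gradient ψ x‖ ^ p) +
          V x * (|Φ x + ψ x| ^ p - |Φ x| ^ p) +
          (C * C0 + M * (2 * C')) * (tsupport η).indicator (fun x => |v n x - Φ x| ^ p) x +
          M * δ * (tsupport η).indicator (fun x => |Φ x + ψ x| ^ p + |Φ x| ^ p) x := by
        filter_upwards [hM] with x hx
        have g1 := grad_interp hp hC hCb (hη0 x) (hη1 x) (hηg x) hδ hC0 (gz x)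
        by_cases hxK : x ∈ tsupport η
        · rw [Set.indicator_of_mem hxK, Set.indicator_of_mem hxK]
          rw [abs_sub_comm] at g1
          have hVx := hx hxK
          have a1 := hCb' (Φ x + ψ x) (z x)
          have a2 := hCb' (Φ x) (v n x)
          have a3 : |Φ x + ψ x - z x| ^ p ≤ |v n x - Φ x| ^ p := by
            refine Real.rpow_le_rpow (abs_nonneg _) ?_ hp0.le
            have : Φ x + ψ x - z x = (1 - η x) * (Φ x - v n x) := by simp only [hz]; ring
            rw [this, abs_mul, abs_sub_comm (v n x)]
            refine mul_le_of_le_one_left (abs_nonneg _) ?_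
            rw [abs_le]; constructor <;> linarith [hη0 x, hη1 x]
          rw [abs_sub_comm (Φ x)] at a2
          have a4 := mul_le_mul_of_nonneg_left a3 hC'.le
          have a5 : V x * (|z x| ^ p - |Φ x + ψ x| ^ p) ≤
              M * (δ * |Φ x + ψ x| ^ p + C' * |v n x - Φ x| ^ p) := by
            refine (le_abs_self _).trans ?_
            rw [abs_mul]
            refine mul_le_mul hVx ?_ (abs_nonneg _) hM0
            rw [abs_sub_comm]; linarith
          have a6 : - (V x * (|v n x| ^ p - |Φ x| ^ p)) ≤
              M * (δ * |Φ x| ^ p + C' * |v n x - Φ x| ^ p) := by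
            refine (neg_le_abs _).trans ?_
            rw [abs_mul]
            refine mul_le_mul hVx ?_ (abs_nonneg _) hM0
            rw [abs_sub_comm]; linarith
          nlinarith
        · rw [Set.indicator_of_notMem hxK, Set.indicator_of_notMem hxK]
          have h1 : z x = v n x := by simp only [hz]; rw [hη0' x hxK, hψ0' x hxK]; ring
          have h2 : gradient z x = gradient (v n) x := by
            rw [gz x, hη0' x hxK, grad_eq_zero hxK]; simp
          rw [h1, h2, hη0' x hxK, hψ0' x hxK]; simp
      have j1 := (i1.add i2).sub i3
      have j2 := j1.add (i4.const_mul (1 + δ))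
      have j3 := j2.add i5
      have j4 := j3.add (i6.const_mul (C * C0 + M * (2 * C')))
      have j5 := j4.add (i7.const_mul (M * δ))
      have hint := integral_mono_ae ((integrable_grad hp hzc).add (integrable_Vabsp hp hV hzc)) j5 pt
      have e1 := integral_add' j4 (i7.const_mul (M * δ))
      have e2 := integral_add' j3 (i6.const_mul (C * C0 + M * (2 * C')))
      have e3 := integral_add' j2 i5
      have e4 := integral_add' j1 (i4.const_mul (1 + δ))
      have e5 := integral_sub' (i1.add i2) i3
      rw [integral_const_mul, integral_indicator hK.measurableSet] at e1 e2
      rw [integral_const_mul] at e4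
      have q1 : Qf p V z = ∫ x, ((fun x => ‖gradient z x‖ ^ p) + fun x => V x * |z x| ^ p) x := rfl
      have q2 : Qf p V (v n) =
        ∫ x, ((fun x => ‖gradient (v n) x‖ ^ p) + fun x => V x * |v n x| ^ p) x := rfl
      rw [q1] at hz0
      rw [q2]
      linarith
    have L := lsc hp hη.1 hη.2.1 hη0 hv hΦ hlim hδ
    have T : Tendsto (fun n => (1 + δ) * (Qf p V (v n) + (1 + δ) * J + R +
        (C * C0 + M * (2 * C')) * (∫ x in tsupport η, |v n x - Φ x| ^ p) + M * δ * S)) atTop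
        (𝓝 ((1 + δ) * (0 + (1 + δ) * J + R + (C * C0 + M * (2 * C')) * 0 + M * δ * S))) :=
      ((((hQ.add_const _).add_const _).add (hlim.const_mul _)).add_const _).const_mul _
    have := ge_of_tendsto T (L.mono (fun n hn => hn.trans
      (mul_le_mul_of_nonneg_left (step n) (by linarith))))
    simpa using this
  have T1 : Tendsto (fun δ : ℝ => I0 - δ) (𝓝[>] 0) (𝓝 (I0 - 0)) :=
    Tendsto.mono_left (Continuous.tendsto (by fun_prop) _) nhdsWithin_le_nhds
  have T2 : Tendsto (fun δ : ℝ => (1 + δ) * ((1 + δ) * J + R + M * δ * S)) (𝓝[>] 0)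
      (𝓝 ((1 + 0) * ((1 + 0) * J + R + M * 0 * S))) :=
    Tendsto.mono_left (Continuous.tendsto (f := fun δ : ℝ => (1 + δ) * ((1 + δ) * J + R + M * δ * S))
      (by fun_prop) 0) nhdsWithin_le_nhds
  have := le_of_tendsto_of_tendsto T1 T2 (by
    filter_upwards [self_mem_nhdsWithin] with δ hδ using main δ hδ)
  simpa using this

end core4

section el
variable {d : ℕ} {Ω : Set (Ed d)} {V : Ed d → ℝ} {p : ℝ}

open scoped Manifold in
lemma cutoff (hΩ : IsOpen Ω) {K : Set (Ed d)} (hK : IsCompact K) (hKΩ : K ⊆ Ω) :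
    ∃ ζ : Ed d → ℝ, C1c Ω ζ ∧ (∀ x, 0 ≤ ζ x ∧ ζ x ≤ 1) ∧
      ∃ O : Set (Ed d), IsOpen O ∧ K ⊆ O ∧ O ⊆ Ω ∧ ∀ x ∈ O, ζ x = 1 := by
  obtain ⟨L, hL, hKL, hLΩ⟩ := exists_compact_between hK hΩ hKΩ
  obtain ⟨f, h1, h2, h3⟩ := exists_contMDiffMap_one_nhds_of_subset_interior (n := 1)
    (𝓘(ℝ, Ed d)) hK.isClosed hKL
  have hsup : tsupport f ⊆ L := closure_minimal (fun x hx => by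
    by_contra h; exact hx (h2 x h)) hL.isClosed
  obtain ⟨O, hO, hKO, hO1⟩ := eventually_nhdsSet_iff_exists.1 h1
  refine ⟨f, ⟨f.contMDiff.contDiff, hL.of_isClosed_subset (isClosed_tsupport _) hsup,
    hsup.trans hLΩ⟩, fun x => h3 x, O ∩ Ω, hO.inter hΩ, Set.subset_inter hKO hKΩ,
    Set.inter_subset_right, fun x hx => hO1 x hx.1⟩

lemma cutoff_p (hp : 1 < p) (hΩ : IsOpen Ω) {K : Set (Ed d)} (hK : IsCompact K) (hKΩ : K ⊆ Ω) :
    ∃ η : Ed d → ℝ, C1c Ω η ∧ (∀ x, 0 ≤ η x) ∧ (∀ x, η x ≤ 1) ∧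
      (∃ C0 : ℝ, 0 ≤ C0 ∧ ∀ x, ‖gradient η x‖ ^ p ≤ C0 * η x ^ (p - 1)) ∧ ∀ x ∈ K, η x = 1 := by
  obtain ⟨ζ, hζ, h01, O, -, hKO, -, hO1⟩ := cutoff hΩ hK hKΩ
  have hp0 : 0 < p := by linarith
  have hsup : tsupport (fun x => |ζ x| ^ p) ⊆ tsupport ζ :=
    closure_mono (fun x hx h => hx (by simp only; rw [h, abs_zero, zero_rpow' hp]))
  obtain ⟨L, hL, hLb⟩ := C1c_bdd (continuous_grad hζ.1)
    (HasCompactSupport.intro hζ.2.1 (fun x hx => grad_eq_zero hx))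
  refine ⟨fun x => |ζ x| ^ p, ⟨contDiff_abs_rpow hp hζ.1,
    hζ.2.1.of_isClosed_subset (isClosed_tsupport _) hsup, hsup.trans hζ.2.2⟩,
    fun x => by positivity, fun x => ?_, ⟨(p * L) ^ p, by positivity, fun x => ?_⟩, fun x hx => ?_⟩
  · exact Real.rpow_le_one (abs_nonneg _) (by rw [abs_of_nonneg (h01 x).1]; exact (h01 x).2) hp0.le
  · rw [grad_abs_rpow hp (hζ.1.differentiable one_ne_zero x), norm_smul, norm_mul, norm_mul,
      Real.norm_of_nonneg hp0.le, Real.norm_of_nonneg (by positivity : 0 ≤ |ζ x| ^ (p - 2)),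
      Real.norm_eq_abs, mul_assoc p, rpow_sub_two_mul (abs_nonneg _) hp, ← Real.rpow_mul (abs_nonneg _),
      mul_comm p (p - 1), Real.rpow_mul (abs_nonneg _), ← Real.mul_rpow (by positivity) (by positivity)]
    refine Real.rpow_le_rpow (by positivity) ?_ hp0.le
    have := hLb x
    have h2 : 0 ≤ p * |ζ x| ^ (p - 1) := by positivity
    nlinarith
  · simp [hO1 x (hKO hx)]

section gen
variable {E : Type*} [NormedAddCommGroup E] [InnerProductSpace ℝ E]

lemma diffq_bounds (hp : 1 < p) (A X : E) {t : ℝ} (ht : 0 < t) :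
    p * ⟪FF p A, X⟫ ≤ t⁻¹ * (‖A + t • X‖ ^ p - ‖A‖ ^ p) ∧
      t⁻¹ * (‖A + t • X‖ ^ p - ‖A‖ ^ p) ≤ p * ⟪FF p (A + t • X), X⟫ := by
  have h1 := breg_nonneg hp (A + t • X) A
  have h2 := breg_nonneg hp A (A + t • X)
  unfold Breg at h1 h2
  rw [add_sub_cancel_left, real_inner_smul_right] at h1
  rw [sub_add_cancel_left, inner_neg_right, real_inner_smul_right] at h2
  constructor
  · rw [le_inv_mul_iff₀ ht]; nlinarith
  · rw [inv_mul_le_iff₀ ht]; nlinarith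

lemma diffq_abs (hp : 1 < p) (A X : E) {t : ℝ} (ht : 0 < t) (ht1 : t ≤ 1) :
    |t⁻¹ * (‖A + t • X‖ ^ p - ‖A‖ ^ p)| ≤ p * ((‖A‖ + ‖X‖) ^ (p - 1) * ‖X‖) := by
  obtain ⟨h1, h2⟩ := diffq_bounds hp A X ht
  have key : ∀ B : E, ‖B‖ ≤ ‖A‖ + ‖X‖ → |⟪FF p B, X⟫| ≤ (‖A‖ + ‖X‖) ^ (p - 1) * ‖X‖ := by
    intro B hB
    refine (abs_real_inner_le_norm _ _).trans ?_
    rw [norm_FF hp]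
    exact mul_le_mul_of_nonneg_right (Real.rpow_le_rpow (norm_nonneg _) hB (by linarith))
      (norm_nonneg _)
  have k1 := abs_le.1 (key A (by linarith [norm_nonneg X]))
  have k2 := abs_le.1 (key (A + t • X) ((norm_add_le _ _).trans (by
    rw [norm_smul, Real.norm_of_nonneg ht.le]; nlinarith [norm_nonneg X])))
  rw [abs_le]
  constructor <;> nlinarith

lemma diffq_lim (hp : 1 < p) (A X : E) {t : ℕ → ℝ} (ht : ∀ n, 0 < t n)
    (hlim : Tendsto t atTop (𝓝 0)) :
    Tendsto (fun n => (t n)⁻¹ * (‖A + t n • X‖ ^ p - ‖A‖ ^ p)) atTop (𝓝 (p * ⟪FF p A, X⟫)) := by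
  refine tendsto_of_tendsto_of_tendsto_of_le_of_le tendsto_const_nhds ?_
    (fun n => (diffq_bounds hp A X (ht n)).1) (fun n => (diffq_bounds hp A X (ht n)).2)
  have h1 : Tendsto (fun n => A + t n • X) atTop (𝓝 (A + (0:ℝ) • X)) :=
    tendsto_const_nhds.add (hlim.smul_const X)
  rw [zero_smul, add_zero] at h1
  exact ((((continuous_FF hp).tendsto A).comp h1).inner tendsto_const_nhds).const_mul p

end gen

lemma el_lim (hp : 1 < p) (hV : LocBddOn Ω V) {Φ ψ : Ed d → ℝ} (hΦ : C1c Ω Φ) (hψ : C1c Ω ψ)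
    {t : ℕ → ℝ} (ht : ∀ n, 0 < t n) (ht1 : ∀ n, t n ≤ 1) (htl : Tendsto t atTop (𝓝 0)) :
    Tendsto (fun n => ∫ x, ((t n)⁻¹ * (‖gradient Φ x + t n • gradient ψ x‖ ^ p - ‖gradient Φ x‖ ^ p) +
    V x * ((t n)⁻¹ * (‖Φ x + t n • ψ x‖ ^ p - ‖Φ x‖ ^ p)))) atTop
      (𝓝 (∫ x, (p * ⟪FF p (gradient Φ x), gradient ψ x⟫ + V x * (p * ⟪FF p (Φ x), ψ x⟫)))) := by
  have hp0 : 0 < p := by linarith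
  have hKψ : IsCompact (tsupport ψ) := hψ.2.1
  have hψ0 : ∀ x, x ∉ tsupport ψ → ψ x = 0 := fun x hx => image_eq_zero_of_notMem_tsupport hx
  have cΦ := hΦ.1.continuous
  have cψ := hψ.1.continuous
  have hgΦ := continuous_grad hΦ.1
  have hgψ := continuous_grad hψ.1
  have cs1 : ∀ c : ℝ, Continuous fun x => c • gradient ψ x := fun c => hgψ.const_smul c
  have cs2 : ∀ c : ℝ, Continuous fun x => c • ψ x := fun c => cψ.const_smul c
  obtain ⟨M, hM⟩ := hV.2 _ hKψ hψ.2.2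
  have cF1 : ∀ n, Continuous fun x => (t n)⁻¹ * (‖gradient Φ x + t n • gradient ψ x‖ ^ p - ‖gradient Φ x‖ ^ p) :=
    fun n => continuous_const.mul ((continuous_norm_rpow hp (hgΦ.add (cs1 _))).sub
      (continuous_norm_rpow hp hgΦ))
  have cF2 : ∀ n, Continuous fun x => (t n)⁻¹ * (‖Φ x + t n • ψ x‖ ^ p - ‖Φ x‖ ^ p) :=
    fun n => continuous_const.mul ((continuous_norm_rpow hp (cΦ.add (cs2 _))).sub
      (continuous_norm_rpow hp cΦ))
  have cb1 : Continuous fun x => p * ((‖gradient Φ x‖ + ‖gradient ψ x‖) ^ (p - 1) * ‖gradient ψ x‖) :=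
    continuous_const.mul (((hgΦ.norm.add hgψ.norm).rpow_const
      (fun _ => Or.inr (by linarith))).mul hgψ.norm)
  have cb2 : Continuous fun x => p * ((‖Φ x‖ + ‖ψ x‖) ^ (p - 1) * ‖ψ x‖) :=
    continuous_const.mul (((cΦ.norm.add cψ.norm).rpow_const
      (fun _ => Or.inr (by linarith))).mul cψ.norm)
  refine tendsto_integral_of_dominated_convergence
    (fun x => p * ((‖gradient Φ x‖ + ‖gradient ψ x‖) ^ (p - 1) * ‖gradient ψ x‖) +
      M * (p * ((‖Φ x‖ + ‖ψ x‖) ^ (p - 1) * ‖ψ x‖))) ?_ ?_ ?_ ?_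
  · intro n
    exact (cF1 n).aestronglyMeasurable.add ((hV.1.mul (cF2 n).measurable).aestronglyMeasurable)
  · exact integrable_of_K (cb1.add (continuous_const.mul cb2)) hKψ
      (fun x hx => by rw [grad_eq_zero hx, hψ0 x hx]; simp)
  · intro n
    filter_upwards [hM] with x hx
    refine (norm_add_le _ _).trans ?_
    rw [norm_mul (V x), Real.norm_eq_abs, Real.norm_eq_abs, Real.norm_eq_abs]
    refine add_le_add (diffq_abs hp _ _ (ht n) (ht1 n)) ?_
    by_cases h : x ∈ tsupport ψ
    · exact mul_le_mul (hx h) (diffq_abs hp _ _ (ht n) (ht1 n)) (abs_nonneg _)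
        ((abs_nonneg _).trans (hx h))
    · rw [hψ0 x h]; simp
  · refine Eventually.of_forall (fun x => ?_)
    exact (diffq_lim hp _ _ ht htl).add ((diffq_lim hp _ _ ht htl).const_mul _)

lemma el_ineq (hp : 1 < p) (hΩ : IsOpen Ω) (hV : LocBddOn Ω V) (hn : NonnegOn p Ω V)
    {η : Ed d → ℝ} (hη : C1c Ω η) (hη0 : ∀ x, 0 ≤ η x) (hη1 : ∀ x, η x ≤ 1) {C0 : ℝ}
    (hC0 : 0 ≤ C0) (hηg : ∀ x, ‖gradient η x‖ ^ p ≤ C0 * η x ^ (p - 1))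
    {v : ℕ → Ed d → ℝ} {Φ ψ : Ed d → ℝ}
    (hv : ∀ n, C1c Ω (v n)) (hΦ : C1c Ω Φ) (hψ : C1c Ω ψ) (hψη : ∀ x ∈ tsupport ψ, η x = 1)
    (hlim : Tendsto (fun n => ∫ x in tsupport η, |v n x - Φ x| ^ p) atTop (𝓝 0))
    (hQ : Tendsto (fun n => Qf p V (v n)) atTop (𝓝 0)) :
    0 ≤ ∫ x, (⟪FF p (gradient Φ x), gradient ψ x⟫ + V x * (FF p (Φ x) * ψ x)) := by
  have hp0 : 0 < p := by linarith
  have hKψ : IsCompact (tsupport ψ) := hψ.2.1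
  have hψ0 : ∀ x, x ∉ tsupport ψ → ψ x = 0 := fun x hx => image_eq_zero_of_notMem_tsupport hx
  have cΦ := hΦ.1.continuous
  have cψ := hψ.1.continuous
  have cη := hη.1.continuous
  have hgΦ := continuous_grad hΦ.1
  have hgψ := continuous_grad hψ.1
  have cs1 : ∀ c : ℝ, Continuous fun x => c • gradient ψ x := fun c => hgψ.const_smul c
  have cs2 : ∀ c : ℝ, Continuous fun x => c • ψ x := fun c => cψ.const_smul c
  obtain ⟨t, ht, ht1, htl⟩ : ∃ t : ℕ → ℝ, (∀ n, 0 < t n) ∧ (∀ n, t n ≤ 1) ∧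
      Tendsto t atTop (𝓝 0) := by
    refine ⟨fun n => 1 / ((n : ℝ) + 1), fun n => by positivity, fun n => ?_,
      tendsto_one_div_add_atTop_nhds_zero_nat⟩
    rw [div_le_one (by positivity)]; linarith [(Nat.cast_nonneg n : (0:ℝ) ≤ n)]
  have lim := el_lim hp hV hΦ hψ ht ht1 htl
  have hpos : ∀ n, 0 ≤ ∫ x, ((t n)⁻¹ * (‖gradient Φ x + t n • gradient ψ x‖ ^ p - ‖gradient Φ x‖ ^ p) +
    V x * ((t n)⁻¹ * (‖Φ x + t n • ψ x‖ ^ p - ‖Φ x‖ ^ p))) := by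
    intro n
    have hψn : C1c Ω (fun x => t n * ψ x) := by
      have hs : tsupport (fun x => t n * ψ x) ⊆ tsupport ψ :=
        closure_mono (fun x hx h => hx (by simp only; rw [h, mul_zero]))
      exact ⟨contDiff_const.mul hψ.1, hKψ.of_isClosed_subset (isClosed_tsupport _) hs,
        hs.trans hψ.2.2⟩
    have hs : tsupport (fun x => t n * ψ x) ⊆ tsupport ψ :=
        closure_mono (fun x hx h => hx (by simp only; rw [h, mul_zero]))
    have := core_min hp hΩ hV hn hη hη0 hη1 hC0 hηg hv hΦ hψn (fun x hx => hψη x (hs hx)) hlim hQ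
    have hη0' : ∀ x, x ∉ tsupport η → η x = 0 := fun x hx => image_eq_zero_of_notMem_tsupport hx
    have gr : ∀ x, gradient (fun x => t n * ψ x) x = t n • gradient ψ x := fun x =>
      grad_const_mul _ (hψ.1.differentiable one_ne_zero x)
    simp only [gr] at this
    have i1 : Integrable (fun x => η x * ‖gradient Φ x‖ ^ p) :=
      integrable_of_K (cη.mul (continuous_norm_rpow hp hgΦ)) hη.2.1
        (fun x hx => by rw [hη0' x hx, zero_mul])
    have i2 : Integrable (fun x => η x * ‖gradient Φ x + t n • gradient ψ x‖ ^ p) :=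
      integrable_of_K (cη.mul (continuous_norm_rpow hp (hgΦ.add (cs1 _)))) hη.2.1
        (fun x hx => by rw [hη0' x hx, zero_mul])
    have i3 : Integrable (fun x => V x * (|Φ x + t n * ψ x| ^ p - |Φ x| ^ p)) :=
      integrable_V hV ((continuous_abs_rpow hp (cΦ.add (continuous_const.mul cψ))).sub
        (continuous_abs_rpow hp cΦ)) hKψ hψ.2.2 (fun x hx => by rw [hψ0 x hx]; simp)
    have e : ∫ x, ((t n)⁻¹ * (‖gradient Φ x + t n • gradient ψ x‖ ^ p - ‖gradient Φ x‖ ^ p) +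
    V x * ((t n)⁻¹ * (‖Φ x + t n • ψ x‖ ^ p - ‖Φ x‖ ^ p))) = (t n)⁻¹ * (((∫ x, η x * ‖gradient Φ x + t n • gradient ψ x‖ ^ p) -
        ∫ x, η x * ‖gradient Φ x‖ ^ p) + ∫ x, V x * (|Φ x + t n * ψ x| ^ p - |Φ x| ^ p)) := by
      rw [← integral_sub' i2 i1, ← integral_add' (i2.sub i1) i3, ← integral_const_mul]
      congr 1
      funext x
      have : ‖gradient Φ x + t n • gradient ψ x‖ ^ p - ‖gradient Φ x‖ ^ p =
          η x * ‖gradient Φ x + t n • gradient ψ x‖ ^ p - η x * ‖gradient Φ x‖ ^ p := by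
        by_cases h : x ∈ tsupport ψ
        · rw [hψη x h]; ring
        · rw [grad_eq_zero h]; simp
      simp only [this, Real.norm_eq_abs, smul_eq_mul, Pi.add_apply, Pi.sub_apply]
      ring
    rw [e]
    exact mul_nonneg (inv_nonneg.2 (ht n).le) (by linarith)
  have := ge_of_tendsto' lim hpos
  have e : (∫ x, (p * ⟪FF p (gradient Φ x), gradient ψ x⟫ + V x * (p * ⟪FF p (Φ x), ψ x⟫))) =
      p * ∫ x, (⟪FF p (gradient Φ x), gradient ψ x⟫ + V x * (FF p (Φ x) * ψ x)) := by
    rw [← integral_const_mul]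
    congr 1
    funext x
    simp only [RCLike.inner_apply, conj_trivial]
    ring
  rw [e] at this
  exact nonneg_of_mul_nonneg_right this hp0

lemma ext_C1 (hΩ : IsOpen Ω) {φ : Ed d → ℝ} (hφ : ContDiffOn ℝ 1 φ Ω) {K : Set (Ed d)}
    (hK : IsCompact K) (hKΩ : K ⊆ Ω) : ∃ Φ : Ed d → ℝ, C1c Ω Φ ∧
      ∃ O : Set (Ed d), IsOpen O ∧ K ⊆ O ∧ O ⊆ Ω ∧ ∀ x ∈ O, Φ x = φ x := by
  obtain ⟨ζ, hζ, h01, O, hO, hKO, hOΩ, hO1⟩ := cutoff hΩ hK hKΩ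
  have hs : tsupport (fun x => ζ x * φ x) ⊆ tsupport ζ :=
    closure_mono (fun x hx h => hx (by simp only; rw [h, zero_mul]))
  refine ⟨fun x => ζ x * φ x, ⟨?_, hζ.2.1.of_isClosed_subset (isClosed_tsupport _) hs,
    hs.trans hζ.2.2⟩, O, hO, hKO, hOΩ, fun x hx => by simp [hO1 x hx]⟩
  rw [contDiff_iff_contDiffAt]
  intro x
  by_cases hx : x ∈ Ω
  · exact hζ.1.contDiffAt.mul (hφ.contDiffAt (hΩ.mem_nhds hx))
  · have h0 : (fun x => ζ x * φ x) =ᶠ[𝓝 x] fun _ => 0 := by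
      have : (tsupport ζ)ᶜ ∈ 𝓝 x :=
        (isClosed_tsupport ζ).isOpen_compl.mem_nhds (fun h => hx (hζ.2.2 h))
      filter_upwards [this] with y hy
      rw [image_eq_zero_of_notMem_tsupport hy, zero_mul]
    exact contDiffAt_const.congr_of_eventuallyEq h0

lemma el_ground (hp : 1 < p) (hΩ : IsOpen Ω) (hV : LocBddOn Ω V) (hn : NonnegOn p Ω V)
    {φ : Ed d → ℝ} (hφ : IsGroundStateOn p Ω V φ) {Φ ψ : Ed d → ℝ} {O : Set (Ed d)}
    (hO : IsOpen O) (hOΩ : O ⊆ Ω) (hΦ : C1c Ω Φ) (hΦO : ∀ x ∈ O, Φ x = φ x)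
    (hψ : C1c O ψ) :
    ∫ x, (⟪FF p (gradient Φ x), gradient ψ x⟫ + V x * (FF p (Φ x) * ψ x)) = 0 := by
  obtain ⟨-, -, v, ⟨hv, -, -, hvQ⟩, hvl⟩ := hφ
  obtain ⟨η, hη, hη0, hη1, ⟨C0, hC0, hηg⟩, hηK⟩ := cutoff_p hp hO hψ.2.1 hψ.2.2
  have hη' : C1c Ω η := ⟨hη.1, hη.2.1, hη.2.2.trans hOΩ⟩
  have hQ : Tendsto (fun n => Qf p V (v n)) atTop (𝓝 0) := by
    refine hvQ.congr (fun n => Qp_eq hp (hv n).2.2 V)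
  have hlim : Tendsto (fun n => ∫ x in tsupport η, |v n x - Φ x| ^ p) atTop (𝓝 0) := by
    refine (hvl _ hη.2.1 hη'.2.2).congr (fun n => ?_)
    refine setIntegral_congr_fun hη.2.1.isCompact.measurableSet (fun x hx => ?_)
    rw [hΦO x (hη.2.2 hx)]
  have h1 := el_ineq hp hΩ hV hn hη' hη0 hη1 hC0 hηg (fun n => (hv n).c1c) hΦ
    (⟨hψ.1, hψ.2.1, hψ.2.2.trans hOΩ⟩ : C1c Ω ψ) hηK hlim hQ
  have hs : tsupport (fun x => (-1) * ψ x) ⊆ tsupport ψ :=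
    closure_mono (fun x hx h => hx (by simp only; rw [h, mul_zero]))
  have h2 := el_ineq hp hΩ hV hn hη' hη0 hη1 hC0 hηg (fun n => (hv n).c1c) hΦ
    (⟨contDiff_const.mul hψ.1, hψ.2.1.of_isClosed_subset (isClosed_tsupport _) hs,
      hs.trans (hψ.2.2.trans hOΩ)⟩ : C1c Ω (fun x => (-1) * ψ x)) (fun x hx => hηK x (hs hx)) hlim hQ
  have e : (∫ x, (⟪FF p (gradient Φ x), gradient (fun x => (-1) * ψ x) x⟫ +
      V x * (FF p (Φ x) * ((-1) * ψ x)))) =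
      - ∫ x, (⟪FF p (gradient Φ x), gradient ψ x⟫ + V x * (FF p (Φ x) * ψ x)) := by
    rw [← integral_neg]
    congr 1
    funext x
    rw [grad_const_mul _ (hψ.1.differentiable one_ne_zero x), real_inner_smul_right]
    ring
  rw [e] at h2
  linarith

end el

section picone
variable {d : ℕ} {Ω : Set (Ed d)} {V : Ed d → ℝ} {p : ℝ}

lemma continuousOn_grad (hΩ : IsOpen Ω) {φ : Ed d → ℝ} (hφ : ContDiffOn ℝ 1 φ Ω) :
    ContinuousOn (gradient φ) Ω := by
  unfold gradient
  exact (InnerProductSpace.toDual ℝ (Ed d)).symm.continuous.comp_continuousOn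
    (hφ.continuousOn_fderiv_of_isOpen hΩ le_rfl)

lemma grad_congr {f g : Ed d → ℝ} {O : Set (Ed d)} (hO : IsOpen O) (h : ∀ x ∈ O, f x = g x)
    {x : Ed d} (hx : x ∈ O) : gradient f x = gradient g x := by
  have : f =ᶠ[𝓝 x] g := by filter_upwards [hO.mem_nhds hx] with y hy using h y hy
  rw [gradient, gradient, this.fderiv_eq]

lemma quot_C1c (hΩ : IsOpen Ω) {φ u : Ed d → ℝ} (hφ : ContDiffOn ℝ 1 φ Ω) (hpos : ∀ x ∈ Ω, 0 < φ x)
    (hu : C1c Ω u) : C1c Ω (fun x => u x / φ x) ∧ tsupport (fun x => u x / φ x) ⊆ tsupport u := by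
  have hs : tsupport (fun x => u x / φ x) ⊆ tsupport u :=
    closure_mono (fun x hx h => hx (by simp only; rw [h, zero_div]))
  refine ⟨⟨?_, hu.2.1.of_isClosed_subset (isClosed_tsupport _) hs, hs.trans hu.2.2⟩, hs⟩
  rw [contDiff_iff_contDiffAt]
  intro x
  by_cases hx : x ∈ Ω
  · exact hu.1.contDiffAt.div (hφ.contDiffAt (hΩ.mem_nhds hx)) (hpos x hx).ne'
  · have h0 : (fun x => u x / φ x) =ᶠ[𝓝 x] fun _ => 0 := by
      have : (tsupport u)ᶜ ∈ 𝓝 x :=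
        (isClosed_tsupport u).isOpen_compl.mem_nhds (fun h => hx (hu.2.2 h))
      filter_upwards [this] with y hy
      rw [image_eq_zero_of_notMem_tsupport hy, zero_div]
    exact contDiffAt_const.congr_of_eventuallyEq h0

lemma picone (hp : 1 < p) (hΩ : IsOpen Ω) (hV : LocBddOn Ω V) (hn : NonnegOn p Ω V)
    {φ : Ed d → ℝ} (hφ : IsGroundStateOn p Ω V φ) {u : Ed d → ℝ} (hu : C1c Ω u) :
    Integrable (fun x => Breg p (gradient u x) ((u x / φ x) • gradient φ x)) ∧
    ∫ x, Breg p (gradient u x) ((u x / φ x) • gradient φ x) = Qf p V u ∧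
    ∀ x, gradient u x - (u x / φ x) • gradient φ x = φ x • gradient (fun y => u y / φ y) x := by
  obtain ⟨hw, hws⟩ := quot_C1c hΩ hφ.1 hφ.2.1 hu
  set w : Ed d → ℝ := fun x => u x / φ x with hwdef
  obtain ⟨Φ, hΦ, O, hO, hKO, hOΩ, hΦO⟩ := ext_C1 hΩ hφ.1 hu.2.1 hu.2.2
  have hw0 : ∀ x, x ∉ tsupport u → w x = 0 := fun x hx =>
    image_eq_zero_of_notMem_tsupport (fun h => hx (hws h))
  have hgw0 : ∀ x, x ∉ tsupport u → gradient w x = 0 := fun x hx =>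
    grad_eq_zero (fun h => hx (hws h))
  have huw : ∀ x, u x = w x * Φ x := by
    intro x
    by_cases hx : x ∈ tsupport u
    · rw [hΦO x (hKO hx), hwdef]
      exact (div_mul_cancel₀ _ (hφ.2.1 x (hu.2.2 hx)).ne').symm
    · rw [hw0 x hx, zero_mul, image_eq_zero_of_notMem_tsupport hx]
  have dw := fun x => hw.1.differentiable one_ne_zero x
  have dΦ := fun x => hΦ.1.differentiable one_ne_zero x
  have gu : ∀ x, gradient u x = w x • gradient Φ x + Φ x • gradient w x := by
    intro x
    rw [show u = fun x => w x * Φ x from funext huw, grad_mul (dw x) (dΦ x)]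
  have gΦ : ∀ x ∈ tsupport u, gradient Φ x = gradient φ x := fun x hx =>
    grad_congr hO hΦO (hKO hx)
  have hgr : ∀ x, w x • gradient φ x = w x • gradient Φ x := by
    intro x
    by_cases hx : x ∈ tsupport u
    · rw [gΦ x hx]
    · rw [hw0 x hx, zero_smul, zero_smul]
  have hψs : tsupport (fun x => |w x| ^ p * Φ x) ⊆ tsupport u := by
    have : Function.support (fun x => |w x| ^ p * Φ x) ⊆ Function.support w := fun x hx h => hx (by
      simp only; rw [h, abs_zero, zero_rpow' hp, zero_mul])
    exact (closure_mono this).trans hws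
  have hψ : C1c O (fun x => |w x| ^ p * Φ x) :=
    ⟨(contDiff_abs_rpow hp hw.1).mul hΦ.1, hu.2.1.of_isClosed_subset (isClosed_tsupport _) hψs,
      hψs.trans hKO⟩
  have EL := el_ground hp hΩ hV hn hφ hO hOΩ hΦ hΦO hψ
  have gψ : ∀ x, gradient (fun x => |w x| ^ p * Φ x) x =
      |w x| ^ p • gradient Φ x + Φ x • ((p * |w x| ^ (p - 2) * w x) • gradient w x) := by
    intro x
    rw [grad_mul ((contDiff_abs_rpow hp hw.1).differentiable one_ne_zero x) (dΦ x),
      grad_abs_rpow hp (dw x)]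
  have pt : ∀ x, Breg p (gradient u x) (w x • gradient φ x) =
      (‖gradient u x‖ ^ p + V x * |u x| ^ p) - (⟪FF p (gradient Φ x),
        gradient (fun x => |w x| ^ p * Φ x) x⟫ + V x * (FF p (Φ x) * (|w x| ^ p * Φ x))) := by
    intro x
    rw [hgr x, gψ x, Breg, FF_smul, norm_smul, Real.norm_eq_abs,
      Real.mul_rpow (abs_nonneg _) (norm_nonneg _)]
    have h1 : gradient u x - w x • gradient Φ x = Φ x • gradient w x := by rw [gu x]; abel
    have h2 : FF p (Φ x) * (|w x| ^ p * Φ x) = |u x| ^ p := by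
      rw [huw x, abs_mul, Real.mul_rpow (abs_nonneg _) (abs_nonneg _), ← abs_rpow_mul_self hp (Φ x)]
      simp only [FF, Real.norm_eq_abs, smul_eq_mul]; ring
    rw [h1, h2, inner_add_right, real_inner_smul_left, real_inner_smul_right, real_inner_smul_right,
      real_inner_smul_right, real_inner_smul_right, inner_FF_self hp]
    ring
  have i1 : Integrable fun x => Breg p (gradient u x) (w x • gradient φ x) := by
    simp only [hgr]
    refine integrable_of_K (continuous_breg hp (continuous_grad hu.1)
      (hw.1.continuous.smul (continuous_grad hΦ.1))) hu.2.1 (fun x hx => ?_)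
    rw [grad_eq_zero hx, hw0 x hx, zero_smul, breg_self]
  refine ⟨i1, ?_, ?_⟩
  · have i2 := (integrable_grad hp hu).add (integrable_Vabsp hp hV hu)
    have e2 : ∫ x, (⟪FF p (gradient Φ x), gradient (fun x => |w x| ^ p * Φ x) x⟫ +
        V x * (FF p (Φ x) * (|w x| ^ p * Φ x))) =
        ∫ x, ((‖gradient u x‖ ^ p + V x * |u x| ^ p) -
          Breg p (gradient u x) (w x • gradient φ x)) := by
      congr 1; funext x; rw [pt x]; ring
    rw [e2] at EL
    have := integral_sub i2 i1
    simp only [Pi.add_apply] at this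
    rw [this] at EL
    unfold Qf
    exact (sub_eq_zero.1 EL).symm
  · intro x
    by_cases hx : x ∈ tsupport u
    · change _ - w x • _ = _
      rw [hgr x, gu x, hΦO x (hKO hx)]; abel
    · change _ - w x • _ = _
      rw [hw0 x hx, grad_eq_zero hx, hgw0 x hx]; simp

lemma coerc (hp : 1 < p) (hΩ : IsOpen Ω) (hV : LocBddOn Ω V) (hn : NonnegOn p Ω V)
    {φ : Ed d → ℝ} (hφ : IsGroundStateOn p Ω V φ) {U : Set (Ed d)} (hU : MeasurableSet U)
    (hUc : IsCompact (closure U))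
    (hUΩ : closure U ⊆ Ω) {δ : ℝ} (hδ : 0 < δ) : ∃ C : ℝ, 0 < C ∧ ∀ u : Ed d → ℝ, C1c Ω u →
      ∫ x in U, ‖gradient (fun y => u y / φ y) x‖ ^ p ≤
        C * Qf p V u + δ * ∫ x in U, |u x / φ x| ^ p := by
  have hp0 : 0 < p := by linarith
  obtain ⟨m, hm, hmφ⟩ := hUc.exists_forall_le' (hφ.1.continuousOn.mono hUΩ)
    (fun x hx => hφ.2.1 x (hUΩ hx))
  obtain ⟨L', hL'⟩ := hUc.exists_bound_of_continuousOn ((continuousOn_grad hΩ hφ.1).mono hUΩ)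
  set L := max L' 0
  have hL : ∀ x ∈ closure U, ‖gradient φ x‖ ≤ L := fun x hx => (hL' x hx).trans (le_max_left _ _)
  have hL0 : 0 ≤ L := le_max_right _ _
  have hmp : 0 < m ^ p := by positivity
  set δ' := δ * m ^ p / (L ^ p + 1)
  have hδ' : 0 < δ' := by positivity
  obtain ⟨C, hC, hCb⟩ := breg_coercive d hp hδ'
  refine ⟨C / m ^ p, by positivity, fun u hu => ?_⟩
  obtain ⟨i1, e1, hd⟩ := picone hp hΩ hV hn hφ hu
  obtain ⟨hw, -⟩ := quot_C1c hΩ hφ.1 hφ.2.1 hu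
  have pt : ∀ x ∈ U, ‖gradient (fun y => u y / φ y) x‖ ^ p ≤
      C / m ^ p * Breg p (gradient u x) ((u x / φ x) • gradient φ x) + δ * |u x / φ x| ^ p := by
    intro x hx
    have hx' := subset_closure hx
    have h1 := hCb (gradient u x) ((u x / φ x) • gradient φ x)
    rw [hd x, norm_smul, norm_smul, Real.mul_rpow (norm_nonneg _) (norm_nonneg _),
      Real.mul_rpow (norm_nonneg _) (norm_nonneg _), Real.norm_eq_abs, Real.norm_eq_abs,
      abs_of_pos (hφ.2.1 x (hUΩ hx'))] at h1
    have h2 : m ^ p ≤ φ x ^ p := Real.rpow_le_rpow hm.le (hmφ x hx') hp0.le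
    have h3 : ‖gradient φ x‖ ^ p ≤ L ^ p := Real.rpow_le_rpow (norm_nonneg _) (hL x hx') hp0.le
    have h4 : δ' * (|u x / φ x| ^ p * ‖gradient φ x‖ ^ p) ≤ δ * m ^ p * |u x / φ x| ^ p := by
      have h5 : δ' * ‖gradient φ x‖ ^ p ≤ δ * m ^ p := by
        have : δ' * (L ^ p + 1) = δ * m ^ p := div_mul_cancel₀ _ (by positivity)
        rw [← this]
        exact mul_le_mul_of_nonneg_left (by linarith) hδ'.le
      have := mul_le_mul_of_nonneg_right h5 (by positivity : 0 ≤ |u x / φ x| ^ p)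
      linarith
    have h6 := mul_le_mul_of_nonneg_right h2
      (by positivity : 0 ≤ ‖gradient (fun y => u y / φ y) x‖ ^ p)
    rw [← mul_le_mul_iff_right₀ hmp]
    have e : m ^ p * (C / m ^ p * Breg p (gradient u x) ((u x / φ x) • gradient φ x) +
        δ * |u x / φ x| ^ p) = C * Breg p (gradient u x) ((u x / φ x) • gradient φ x) +
        δ * m ^ p * |u x / φ x| ^ p := by field_simp
    rw [e]; linarith
  have ia : IntegrableOn (fun x => |u x / φ x| ^ p) U := (integrable_absp hp hw).integrableOn
  have hint := setIntegral_mono_on (integrable_grad hp hw).integrableOn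
    ((i1.integrableOn.const_mul (C / m ^ p)).add (ia.const_mul δ)) hU pt
  have e2 := integral_add' (μ := volume.restrict U) (i1.integrableOn.const_mul (C / m ^ p)) (ia.const_mul δ)
  rw [integral_const_mul, integral_const_mul] at e2
  have h7 : ∫ x in U, Breg p (gradient u x) ((u x / φ x) • gradient φ x) ≤ Qf p V u := by
    rw [← e1]
    exact setIntegral_le_integral i1 (Eventually.of_forall (fun x => breg_nonneg hp _ _))
  have h8 := mul_le_mul_of_nonneg_left h7 (by positivity : 0 ≤ C / m ^ p)
  linarith

end picone

section poincare
variable {d : ℕ} {Ω : Set (Ed d)} {p : ℝ}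

open scoped ENNReal

lemma seg_bound (hp : 1 < p) {w : Ed d → ℝ} (hw : ContDiff ℝ 1 w) (x y : Ed d) {R : ℝ}
    (hR : ‖x - y‖ ≤ R) :
    |w x - w y| ^ p ≤ R ^ p * ∫ t in Set.Icc (0:ℝ) 1, ‖gradient w (y + t • (x - y))‖ ^ p := by
  have hp0 : 0 < p := by linarith
  have hR0 : 0 ≤ R := (norm_nonneg _).trans hR
  have hl : Continuous fun t : ℝ => y + t • (x - y) := by fun_prop
  have cg : Continuous fun t : ℝ => ‖gradient w (y + t • (x - y))‖ :=
    ((continuous_grad hw).comp hl).norm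
  have hder : ∀ t ∈ Set.uIcc (0:ℝ) 1, HasDerivAt (fun t : ℝ => w (y + t • (x - y)))
      (⟪x - y, gradient w (y + t • (x - y))⟫) t := by
    intro t _
    rw [inner_grad]
    have h1 : HasDerivAt (fun t : ℝ => y + t • (x - y)) (x - y) t := by
      simpa using ((hasDerivAt_id t).smul_const (x - y)).const_add y
    exact (hw.differentiable one_ne_zero _).hasFDerivAt.comp_hasDerivAt t h1
  have cd : Continuous fun t : ℝ => ⟪x - y, gradient w (y + t • (x - y))⟫ :=
    continuous_const.inner ((continuous_grad hw).comp hl)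
  have ftc := intervalIntegral.integral_eq_sub_of_hasDerivAt hder (cd.intervalIntegrable 0 1)
  simp only [one_smul, zero_smul, add_zero, add_sub_cancel] at ftc
  have hb : |w x - w y| ≤ R * ∫ t in Set.Icc (0:ℝ) 1, ‖gradient w (y + t • (x - y))‖ := by
    rw [← ftc, ← integral_const_mul, intervalIntegral.integral_of_le zero_le_one,
      ← integral_Icc_eq_integral_Ioc, ← Real.norm_eq_abs]
    refine norm_integral_le_of_norm_le
      ((continuous_const.mul cg).continuousOn.integrableOn_compact isCompact_Icc)
      (Eventually.of_forall (fun t => ?_))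
    refine (norm_inner_le_norm _ _).trans ?_
    exact mul_le_mul_of_nonneg_right hR (norm_nonneg _)
  have hI0 : 0 ≤ ∫ t in Set.Icc (0:ℝ) 1, ‖gradient w (y + t • (x - y))‖ :=
    integral_nonneg (fun t => norm_nonneg _)
  refine (Real.rpow_le_rpow (abs_nonneg _) hb hp0.le).trans ?_
  rw [Real.mul_rpow hR0 hI0]
  refine mul_le_mul_of_nonneg_left ?_ (by positivity)
  haveI : IsProbabilityMeasure (volume.restrict (Set.Icc (0:ℝ) 1)) := ⟨by simp⟩
  exact ConvexOn.map_integral_le (convexOn_rpow hp.le)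
    (Real.continuous_rpow_const hp0.le).continuousOn isClosed_Ici
    (Eventually.of_forall (fun t => norm_nonneg _))
    (cg.continuousOn.integrableOn_compact isCompact_Icc)
    ((cg.rpow_const (fun _ => Or.inr hp0.le)).continuousOn.integrableOn_compact isCompact_Icc)

lemma lint_affine {G : Ed d → ℝ≥0∞} (hG : Measurable G) (a : Ed d) {s : ℝ} (hs : 1 / 2 ≤ s) :
    ∫⁻ x, G (a + s • x) ≤ 2 ^ d * ∫⁻ x, G x := by
  have hs0 : 0 < s := by linarith
  have h1 : ∫⁻ x, G (a + s • x) = ∫⁻ z, G (a + z) ∂(Measure.map (s • ·) (volume : Measure (Ed d))) := by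
    exact (lintegral_map (f := fun z => G (a + z)) (g := fun x : Ed d => s • x)
      (hG.comp (measurable_const_add a)) (measurable_const_smul s)).symm
  rw [h1, Measure.map_addHaar_smul volume hs0.ne', lintegral_smul_measure,
    lintegral_add_left_eq_self G a, smul_eq_mul]
  refine mul_le_mul_left ?_ _
  rw [finrank_euclideanSpace_fin, abs_of_pos (by positivity), ← inv_pow,
    ENNReal.ofReal_pow (by positivity)]
  refine pow_le_pow_left' ?_ d
  rw [show (2 : ℝ≥0∞) = ENNReal.ofReal 2 by simp]
  refine ENNReal.ofReal_le_ofReal ?_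
  rw [inv_le_comm₀ hs0 two_pos]; linarith

lemma lint_double {G : Ed d → ℝ≥0∞} (hG : Measurable G) {B : Set (Ed d)} :
    ∫⁻ y in B, ∫⁻ x in B, ∫⁻ t in Set.Icc (0:ℝ) 1, G (y + t • (x - y)) ≤
      volume B * (2 ^ d * ∫⁻ x, G x) := by
  have m3 : Measurable fun q : (Ed d × ℝ) × Ed d => G (q.1.1 + q.1.2 • (q.2 - q.1.1)) :=
    hG.comp (by fun_prop)
  have e1 : ∀ y, ∫⁻ x in B, ∫⁻ t in Set.Icc (0:ℝ) 1, G (y + t • (x - y)) =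
      ∫⁻ t in Set.Icc (0:ℝ) 1, ∫⁻ x in B, G (y + t • (x - y)) := by
    intro y
    refine lintegral_lintegral_swap (Measurable.aemeasurable ?_)
    exact hG.comp (by fun_prop : Measurable fun q : Ed d × ℝ => y + q.2 • (q.1 - y))
  simp only [e1]
  rw [lintegral_lintegral_swap (Measurable.aemeasurable (Measurable.lintegral_prod_right' m3))]
  have key : ∀ t ∈ Set.Icc (0:ℝ) 1, ∫⁻ y in B, ∫⁻ x in B, G (y + t • (x - y)) ≤
      volume B * (2 ^ d * ∫⁻ x, G x) := by
    intro t ht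
    by_cases h : 1 / 2 ≤ t
    · calc ∫⁻ y in B, ∫⁻ x in B, G (y + t • (x - y))
          ≤ ∫⁻ _ in B, (2 ^ d * ∫⁻ x, G x) := by
            refine lintegral_mono (fun y => ?_)
            refine (setLIntegral_le_lintegral _ _).trans ?_
            have : ∀ x, y + t • (x - y) = (y - t • y) + t • x := fun x => by module
            simp only [this]
            exact lint_affine hG _ h
        _ = volume B * (2 ^ d * ∫⁻ x, G x) := by rw [setLIntegral_const, mul_comm]
    · have e2 : ∫⁻ y in B, ∫⁻ x in B, G (y + t • (x - y)) =
          ∫⁻ x in B, ∫⁻ y in B, G (y + t • (x - y)) := by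
        refine lintegral_lintegral_swap (Measurable.aemeasurable ?_)
        exact hG.comp (by fun_prop : Measurable fun q : Ed d × Ed d => q.1 + t • (q.2 - q.1))
      rw [e2]
      calc ∫⁻ x in B, ∫⁻ y in B, G (y + t • (x - y))
          ≤ ∫⁻ _ in B, (2 ^ d * ∫⁻ x, G x) := by
            refine lintegral_mono (fun x => ?_)
            refine (setLIntegral_le_lintegral _ _).trans ?_
            have : ∀ y, y + t • (x - y) = t • x + (1 - t) • y := fun x => by module
            simp only [this]
            exact lint_affine hG _ (by linarith)
        _ = volume B * (2 ^ d * ∫⁻ x, G x) := by rw [setLIntegral_const, mul_comm]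
  calc ∫⁻ t in Set.Icc (0:ℝ) 1, ∫⁻ y in B, ∫⁻ x in B, G (y + t • (x - y))
      ≤ ∫⁻ _ in Set.Icc (0:ℝ) 1, volume B * (2 ^ d * ∫⁻ x, G x) :=
        setLIntegral_mono' measurableSet_Icc key
    _ = volume B * (2 ^ d * ∫⁻ x, G x) := by rw [setLIntegral_const]; simp

lemma integrableOn_bdd {f : Ed d → ℝ} (hf : Continuous f) {U : Set (Ed d)}
    (hU : IsCompact (closure U)) : IntegrableOn f U :=
  (hf.continuousOn.integrableOn_compact hU).mono_set subset_closure

lemma poincare_ball (hp : 1 < p) (x₀ : Ed d) {r : ℝ} (hr : 0 < r) : ∃ C : ℝ, 0 ≤ C ∧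
    ∀ w : Ed d → ℝ, ContDiff ℝ 1 w → ∃ c : ℝ, ∫ x in Metric.ball x₀ r, |w x - c| ^ p ≤
      C * ∫ x in Metric.ball x₀ r, ‖gradient w x‖ ^ p := by
  have hp0 : 0 < p := by linarith
  set B := Metric.ball x₀ r with hB
  have hBm : MeasurableSet B := measurableSet_ball
  have hBc : IsCompact (closure B) :=
    (isCompact_closedBall x₀ r).of_isClosed_subset isClosed_closure Metric.closure_ball_subset_closedBall
  have hB0 : volume B ≠ 0 := (Metric.measure_ball_pos volume x₀ hr).ne'
  have hBt : volume B ≠ ∞ := measure_ball_lt_top.ne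
  refine ⟨(2 * r) ^ p * 2 ^ d, by positivity, fun w hw => ?_⟩
  have cg := continuous_norm_rpow hp (continuous_grad hw)
  set G : Ed d → ℝ≥0∞ := B.indicator (fun x => ENNReal.ofReal (‖gradient w x‖ ^ p)) with hG
  have hGm : Measurable G := (ENNReal.measurable_ofReal.comp cg.measurable).indicator hBm
  have stepA : ∀ y ∈ B, ∀ x ∈ B, ENNReal.ofReal (|w x - w y| ^ p) ≤
      ENNReal.ofReal ((2 * r) ^ p) * ∫⁻ t in Set.Icc (0:ℝ) 1, G (y + t • (x - y)) := by
    intro y hy x hx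
    have hd : ‖x - y‖ ≤ 2 * r := by
      rw [← dist_eq_norm]
      have := dist_triangle_right x y x₀
      rw [hB, Metric.mem_ball] at hx hy
      linarith
    refine (ENNReal.ofReal_le_ofReal (seg_bound hp hw x y hd)).trans ?_
    rw [ENNReal.ofReal_mul (by positivity)]
    refine mul_le_mul_right (le_of_eq ?_) _
    have cl : Continuous fun t : ℝ => ‖gradient w (y + t • (x - y))‖ ^ p :=
      cg.comp (by fun_prop : Continuous fun t : ℝ => y + t • (x - y))
    rw [ofReal_integral_eq_lintegral_ofReal (cl.continuousOn.integrableOn_compact isCompact_Icc)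
      (Eventually.of_forall (fun t => by positivity))]
    refine setLIntegral_congr_fun measurableSet_Icc (fun t ht => ?_)
    have : y + t • (x - y) ∈ B :=
      (convex_ball x₀ r).add_smul_sub_mem hy hx ht
    simp only [hG]
    rw [Set.indicator_of_mem this]
  have cw : Continuous fun q : Ed d × Ed d => |w q.2 - w q.1| ^ p :=
    continuous_abs_rpow hp ((hw.continuous.comp continuous_snd).sub (hw.continuous.comp continuous_fst))
  have hfm : Measurable fun y => ∫⁻ x in B, ENNReal.ofReal (|w x - w y| ^ p) :=
    Measurable.lintegral_prod_right' (f := fun q : Ed d × Ed d => ENNReal.ofReal (|w q.2 - w q.1| ^ p))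
      (ENNReal.measurable_ofReal.comp cw.measurable)
  obtain ⟨y, hy, hyle⟩ := exists_le_setLAverage hB0 hBt hfm.aemeasurable
  have tot : ∫⁻ y in B, ∫⁻ x in B, ENNReal.ofReal (|w x - w y| ^ p) ≤
      ENNReal.ofReal ((2 * r) ^ p) * (volume B * (2 ^ d * ∫⁻ x, G x)) := by
    calc ∫⁻ y in B, ∫⁻ x in B, ENNReal.ofReal (|w x - w y| ^ p)
        ≤ ∫⁻ y in B, ∫⁻ x in B, ENNReal.ofReal ((2 * r) ^ p) *
            ∫⁻ t in Set.Icc (0:ℝ) 1, G (y + t • (x - y)) :=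
          setLIntegral_mono' hBm (fun y hy => setLIntegral_mono' hBm (fun x hx => stepA y hy x hx))
      _ = ENNReal.ofReal ((2 * r) ^ p) * ∫⁻ y in B, ∫⁻ x in B,
            ∫⁻ t in Set.Icc (0:ℝ) 1, G (y + t • (x - y)) := by
          simp_rw [lintegral_const_mul' _ _ ENNReal.ofReal_ne_top]
      _ ≤ _ := mul_le_mul_right (lint_double hGm) _
  have hGe : ∫⁻ x, G x = ENNReal.ofReal (∫ x in B, ‖gradient w x‖ ^ p) := by
    rw [ofReal_integral_eq_lintegral_ofReal (integrableOn_bdd cg hBc)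
      (Eventually.of_forall (fun t => by positivity)), hG, lintegral_indicator hBm]
  refine ⟨w y, ?_⟩
  have cwy : Continuous fun x => |w x - w y| ^ p :=
    continuous_abs_rpow hp (hw.continuous.sub continuous_const)
  have h0 : 0 ≤ ∫ x in B, ‖gradient w x‖ ^ p := integral_nonneg (fun t => by positivity)
  rw [← ENNReal.ofReal_le_ofReal_iff (by positivity),
    ofReal_integral_eq_lintegral_ofReal (integrableOn_bdd cwy hBc)
      (Eventually.of_forall (fun t => by positivity))]
  refine hyle.trans ?_
  rw [setLAverage_eq, ENNReal.div_le_iff hB0 hBt]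
  refine tot.trans (le_of_eq ?_)
  rw [hGe, ENNReal.ofReal_mul (by positivity), ENNReal.ofReal_mul (by positivity),
    ENNReal.ofReal_pow (by norm_num)]
  simp only [ENNReal.ofReal_ofNat]
  ring

def Poin (p : ℝ) (Ω U : Set (Ed d)) : Prop :=
  IsOpen U ∧ IsCompact (closure U) ∧ closure U ⊆ Ω ∧ ∃ C : ℝ, 0 ≤ C ∧
    ∀ w : Ed d → ℝ, ContDiff ℝ 1 w → ∃ c : ℝ, ∫ x in U, |w x - c| ^ p ≤
      C * ∫ x in U, ‖gradient w x‖ ^ p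

lemma poin_ball (hp : 1 < p) (hΩ : IsOpen Ω) {x : Ed d} (hx : x ∈ Ω) :
    ∃ U, Poin p Ω U ∧ x ∈ U := by
  obtain ⟨r, hr, hrΩ⟩ := Metric.nhds_basis_closedBall.mem_iff.1 (hΩ.mem_nhds hx)
  exact ⟨Metric.ball x r, ⟨Metric.isOpen_ball, (isCompact_closedBall x r).of_isClosed_subset
    isClosed_closure Metric.closure_ball_subset_closedBall,
    Metric.closure_ball_subset_closedBall.trans hrΩ, poincare_ball hp x hr⟩, Metric.mem_ball_self hr⟩

lemma add_rpow_simple (hp : 1 < p) : ∃ C : ℝ, 0 < C ∧ ∀ a b : ℝ,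
    |a + b| ^ p ≤ C * (|a| ^ p + |b| ^ p) := by
  obtain ⟨C, hC, h⟩ := add_rpow_bound (G := ℝ) hp one_pos
  refine ⟨2 + C, by linarith, fun a b => ?_⟩
  have h1 := h a b
  simp only [Real.norm_eq_abs] at h1
  have h2 : 0 ≤ |a| ^ p := by positivity
  have h3 : 0 ≤ |b| ^ p := by positivity
  nlinarith

lemma poin_union (hp : 1 < p) {U₁ U₂ : Set (Ed d)} (h₁ : Poin p Ω U₁) (h₂ : Poin p Ω U₂)
    (hne : (U₁ ∩ U₂).Nonempty) : Poin p Ω (U₁ ∪ U₂) := by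
  obtain ⟨o1, c1, s1, C1, hC1, H1⟩ := h₁
  obtain ⟨o2, c2, s2, C2, hC2, H2⟩ := h₂
  refine ⟨o1.union o2, by rw [closure_union]; exact c1.union c2,
    by rw [closure_union]; exact Set.union_subset s1 s2, ?_⟩
  obtain ⟨A, hA, hAb⟩ := add_rpow_simple hp
  have hIo : IsOpen (U₁ ∩ U₂) := o1.inter o2
  have hfin : ∀ {S : Set (Ed d)}, S ⊆ closure U₂ → volume S ≠ ∞ := fun h =>
    ((measure_mono h).trans_lt c2.measure_lt_top).ne
  set m := volume.real (U₁ ∩ U₂)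
  have hm : 0 < m := ENNReal.toReal_pos (hIo.measure_pos volume hne).ne'
    (hfin (Set.inter_subset_right.trans subset_closure))
  set m2 := volume.real U₂
  have hm2 : 0 ≤ m2 := measureReal_nonneg
  refine ⟨C1 + A * C2 + A * (m2 * (A * (C1 + C2) / m)), by positivity, fun w hw => ?_⟩
  obtain ⟨k1, hk1⟩ := H1 w hw
  obtain ⟨k2, hk2⟩ := H2 w hw
  refine ⟨k1, ?_⟩
  have cg := continuous_norm_rpow hp (continuous_grad hw)
  have cw : ∀ k, Continuous fun x => |w x - k| ^ p := fun k =>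
    continuous_abs_rpow hp (hw.continuous.sub continuous_const)
  have cU : IsCompact (closure (U₁ ∪ U₂)) := by rw [closure_union]; exact c1.union c2
  set T := ∫ x in U₁ ∪ U₂, ‖gradient w x‖ ^ p
  have mono : ∀ {f : Ed d → ℝ} {S S' : Set (Ed d)}, Continuous f → (∀ x, 0 ≤ f x) → S ⊆ S' →
      IsCompact (closure S') → ∫ x in S, f x ≤ ∫ x in S', f x := fun hf h0 hs hc =>
    setIntegral_mono_set (integrableOn_bdd hf hc) (Eventually.of_forall h0)
      (Eventually.of_forall hs)
  have p0 : ∀ k x, 0 ≤ |w x - k| ^ p := fun k x => by positivity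
  have t1 : ∫ x in U₁, ‖gradient w x‖ ^ p ≤ T :=
    mono cg (fun x => by positivity) Set.subset_union_left cU
  have t2 : ∫ x in U₂, ‖gradient w x‖ ^ p ≤ T :=
    mono cg (fun x => by positivity) Set.subset_union_right cU
  have b1 : ∫ x in U₁, |w x - k1| ^ p ≤ C1 * T := hk1.trans (mul_le_mul_of_nonneg_left t1 hC1)
  have b2 : ∫ x in U₂, |w x - k2| ^ p ≤ C2 * T := hk2.trans (mul_le_mul_of_nonneg_left t2 hC2)
  have q1 : m * |k2 - k1| ^ p ≤ A * ((C1 + C2) * T) := by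
    have e : ∫ x in U₁ ∩ U₂, |k2 - k1| ^ p = m * |k2 - k1| ^ p := by
      rw [setIntegral_const, smul_eq_mul]
    rw [← e]
    have cI : IsCompact (closure (U₁ ∩ U₂)) :=
      c1.of_isClosed_subset isClosed_closure (closure_mono Set.inter_subset_left)
    have i1 := integrableOn_bdd (cw k1) cI
    have i2 := integrableOn_bdd (cw k2) cI
    have : ∫ x in U₁ ∩ U₂, |k2 - k1| ^ p ≤
        ∫ x in U₁ ∩ U₂, A * (|w x - k1| ^ p + |w x - k2| ^ p) := by
      refine integral_mono (integrableOn_bdd continuous_const cI) ((i1.add i2).const_mul A) ?_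
      intro x
      have := hAb (w x - k1) (-(w x - k2))
      rw [abs_neg] at this
      have e : w x - k1 + -(w x - k2) = k2 - k1 := by ring
      rw [e] at this
      exact this
    rw [integral_const_mul, integral_add i1 i2] at this
    refine this.trans (mul_le_mul_of_nonneg_left ?_ hA.le)
    have a1 := mono (cw k1) (p0 k1) (Set.inter_subset_left (s := U₁) (t := U₂)) c1
    have a2 := mono (cw k2) (p0 k2) (Set.inter_subset_right (s := U₁) (t := U₂)) c2
    linarith
  have q2 : |k2 - k1| ^ p ≤ A * (C1 + C2) / m * T := by
    rw [div_mul_eq_mul_div, le_div_iff₀ hm]; linarith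
  have q3 : ∫ x in U₂, |w x - k1| ^ p ≤ A * (C2 * T + m2 * (A * (C1 + C2) / m * T)) := by
    have i2 := integrableOn_bdd (cw k2) c2
    have ic : IntegrableOn (fun _ : Ed d => |k2 - k1| ^ p) U₂ := integrableOn_bdd continuous_const c2
    have : ∫ x in U₂, |w x - k1| ^ p ≤ ∫ x in U₂, A * (|w x - k2| ^ p + |k2 - k1| ^ p) := by
      refine integral_mono (integrableOn_bdd (cw k1) c2) ((i2.add ic).const_mul A) ?_
      intro x
      have := hAb (w x - k2) (k2 - k1)
      rw [sub_add_sub_cancel] at this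
      exact this
    rw [integral_const_mul, integral_add i2 ic, setIntegral_const, smul_eq_mul] at this
    refine this.trans (mul_le_mul_of_nonneg_left ?_ hA.le)
    have := mul_le_mul_of_nonneg_left q2 hm2
    linarith
  have q4 : ∫ x in U₁ ∪ U₂, |w x - k1| ^ p ≤
      (∫ x in U₁, |w x - k1| ^ p) + ∫ x in U₂, |w x - k1| ^ p := by
    have e : U₁ ∪ U₂ = U₁ ∪ (U₂ \ U₁) := by simp
    rw [e, setIntegral_union Set.disjoint_sdiff_right (o2.measurableSet.diff o1.measurableSet)
      (integrableOn_bdd (cw k1) c1) ((integrableOn_bdd (cw k1) c2).mono_set Set.diff_subset)]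
    have := mono (cw k1) (p0 k1) (Set.diff_subset (s := U₂) (t := U₁)) c2
    linarith
  linarith

lemma poin_compact (hp : 1 < p) (hΩ : IsOpen Ω) (hc : IsConnected Ω) {x₀ : Ed d} (hx₀ : x₀ ∈ Ω)
    {K : Set (Ed d)} (hK : IsCompact K) (hKΩ : K ⊆ Ω) :
    ∃ U, Poin p Ω U ∧ x₀ ∈ U ∧ K ⊆ U := by
  have pts : ∀ x ∈ Ω, ∃ U, Poin p Ω U ∧ x₀ ∈ U ∧ x ∈ U := by
    let S : Set (Ed d) := {x | ∃ U, Poin p Ω U ∧ x₀ ∈ U ∧ x ∈ U}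
    have hS : IsOpen S := by
      rw [isOpen_iff_mem_nhds]
      rintro x ⟨U, hU, h0, hx⟩
      filter_upwards [hU.1.mem_nhds hx] with y hy using ⟨U, hU, h0, hy⟩
    refine hc.isPreconnected.subset_of_closure_inter_subset (u := S) hS ?_ ?_
    · obtain ⟨U, hU, h0⟩ := poin_ball hp hΩ hx₀
      exact ⟨x₀, hx₀, U, hU, h0, h0⟩
    · rintro x ⟨hxS, hx⟩
      obtain ⟨U, hU, hxU⟩ := poin_ball hp hΩ hx
      obtain ⟨y, hyU, U', hU', h0, hyU'⟩ := mem_closure_iff.1 hxS U hU.1 hxU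
      exact ⟨U' ∪ U, poin_union hp hU' hU ⟨y, hyU', hyU⟩, Or.inl h0, Or.inr hxU⟩
  refine hK.induction_on (p := fun s => ∃ U, Poin p Ω U ∧ x₀ ∈ U ∧ s ⊆ U) ?_ ?_ ?_ ?_
  · obtain ⟨U, hU, h0⟩ := poin_ball hp hΩ hx₀
    exact ⟨U, hU, h0, Set.empty_subset _⟩
  · rintro s t hst ⟨U, hU, h0, ht⟩
    exact ⟨U, hU, h0, hst.trans ht⟩
  · rintro s t ⟨U, hU, h0, hs⟩ ⟨U', hU', h0', ht⟩
    exact ⟨U ∪ U', poin_union hp hU hU' ⟨x₀, h0, h0'⟩, Or.inl h0, Set.union_subset_union hs ht⟩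
  · intro x hx
    obtain ⟨U, hU, h0, hxU⟩ := pts x (hKΩ hx)
    exact ⟨U, mem_nhdsWithin_of_mem_nhds (hU.1.mem_nhds hxU), U, hU, h0, subset_rfl⟩

end poincare

section subcrit
variable {d : ℕ} {Ω : Set (Ed d)} {V : Ed d → ℝ} {p : ℝ}

lemma near_const (hp : 1 < p) (hΩ : IsOpen Ω) (hV : LocBddOn Ω V) (hn : NonnegOn p Ω V)
    {φ : Ed d → ℝ} (hφ : IsGroundStateOn p Ω V φ) {U : Set (Ed d)} (hU : Poin p Ω U)
    {η : ℝ} (hη : 0 < η) : ∃ C : ℝ, 0 < C ∧ ∀ u, C1c Ω u → ∃ c : ℝ,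
      ∫ x in U, |u x / φ x - c| ^ p ≤ C * Qf p V u + η * |c| ^ p := by
  obtain ⟨hUo, hUc, hUΩ, CP, hCP, hP⟩ := hU
  obtain ⟨C1, hC1, h1⟩ := add_rpow_simple hp
  set vol := volume.real U with hvol
  have hvol0 : 0 ≤ vol := measureReal_nonneg
  set δ := min (1 / (2 * (CP + 1) * C1)) (η / (2 * (CP + 1) * C1 * (vol + 1))) with hδ
  have hδ0 : 0 < δ := lt_min (by positivity) (by positivity)
  obtain ⟨C, hC, hc⟩ := coerc hp hΩ hV hn hφ hUo.measurableSet hUc hUΩ hδ0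
  refine ⟨2 * (CP + 1) * C, by positivity, fun u hu => ?_⟩
  have hw := (quot_C1c hΩ hφ.1 hφ.2.1 hu).1
  obtain ⟨c, hcw⟩ := hP _ hw.1
  refine ⟨c, ?_⟩
  have h2 := hc u hu
  set E := ∫ x in U, |u x / φ x - c| ^ p with hE
  set A := ∫ x in U, |u x / φ x| ^ p with hA
  set G := ∫ x in U, ‖gradient (fun y => u y / φ y) x‖ ^ p with hG
  have hG0 : 0 ≤ G := integral_nonneg fun x => by positivity
  have hQ : 0 ≤ Qf p V u := nonneg_C1 hp hΩ hV hn hu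
  have iE : IntegrableOn (fun x => |u x / φ x - c| ^ p) U :=
    integrableOn_bdd (continuous_abs_rpow hp (hw.1.continuous.sub continuous_const)) hUc
  have iA : IntegrableOn (fun x => |u x / φ x| ^ p) U :=
    integrableOn_bdd (continuous_abs_rpow hp hw.1.continuous) hUc
  have ic : IntegrableOn (fun _ : Ed d => |c| ^ p) U :=
    integrableOn_bdd continuous_const hUc
  have h3 : A ≤ C1 * (E + vol * |c| ^ p) := by
    have e : C1 * (E + vol * |c| ^ p) =
        ∫ x in U, C1 * (|u x / φ x - c| ^ p + |c| ^ p) := by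
      rw [integral_const_mul, integral_add iE ic, setIntegral_const, smul_eq_mul]
    rw [e]
    refine integral_mono iA ((iE.add ic).const_mul C1) fun x => ?_
    have := h1 (u x / φ x - c) c
    simpa using this
  have hc0 : 0 ≤ |c| ^ p := by positivity
  have hE0 : 0 ≤ E := integral_nonneg fun x => by positivity
  have h4 : (CP + 1) * (δ * C1) ≤ 1 / 2 := by
    have : δ ≤ 1 / (2 * (CP + 1) * C1) := min_le_left _ _
    rw [le_div_iff₀ (by positivity)] at this
    linarith
  have h5 : (CP + 1) * (δ * C1) * vol ≤ η / 2 := by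
    have : δ ≤ η / (2 * (CP + 1) * C1 * (vol + 1)) := min_le_right _ _
    rw [le_div_iff₀ (by positivity)] at this
    have h6 : 0 ≤ (CP + 1) * (δ * C1) := by positivity
    nlinarith
  have h6 : E ≤ (CP + 1) * (C * Qf p V u + δ * (C1 * (E + vol * |c| ^ p))) := by
    calc E ≤ CP * G := hcw
      _ ≤ (CP + 1) * G := by nlinarith
      _ ≤ (CP + 1) * (C * Qf p V u + δ * A) := mul_le_mul_of_nonneg_left h2 (by positivity)
      _ ≤ _ := by gcongr
  have h7 := mul_le_mul_of_nonneg_right h4 hE0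
  have h8 := mul_le_mul_of_nonneg_right h5 hc0
  nlinarith

lemma weight_bound (hp : 1 < p) (hΩ : IsOpen Ω) (hV : LocBddOn Ω V) (hn : NonnegOn p Ω V)
    {φ : Ed d → ℝ} (hφ : IsGroundStateOn p Ω V φ) {U : Set (Ed d)} (hU : Poin p Ω U)
    {h : Ed d → ℝ} (hm : AEStronglyMeasurable h (volume.restrict U)) {M : ℝ}
    (hM : ∀ᵐ x ∂(volume.restrict U), |h x| ≤ M) (hI : 0 < ∫ x in U, h x) :
    ∃ κ C : ℝ, 0 < κ ∧ 0 < C ∧ ∀ u, C1c Ω u →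
      κ * ∫ x in U, |u x / φ x| ^ p ≤ (∫ x in U, h x * |u x / φ x| ^ p) + C * Qf p V u := by
  set I := ∫ x in U, h x with hIdef
  set vol := volume.real U with hvol
  have hvol0 : 0 ≤ vol := measureReal_nonneg
  have hUc := hU.2.1
  set M' := |M| + 1 with hM'
  have hM'0 : 0 < M' := by positivity
  have hMM : ∀ᵐ x ∂(volume.restrict U), |h x| ≤ M' := by
    filter_upwards [hM] with x hx
    have := le_abs_self M
    linarith
  obtain ⟨C1, hC1, h1⟩ := add_rpow_simple hp
  set δ := I / (4 * M' * (vol + 1)) with hδ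
  have hδ0 : 0 < δ := by positivity
  obtain ⟨C2, hC2, h2⟩ := abs_rpow_diff hp hδ0
  set η := I / (4 * M' * C2) with hη
  have hη0 : 0 < η := by positivity
  obtain ⟨C, hC, hc⟩ := near_const hp hΩ hV hn hφ hU hη0
  set κ := I / (2 * (C1 * (η + vol))) with hκ
  have hκ0 : 0 < κ := by positivity
  refine ⟨κ, κ * C1 * C + M' * C2 * C, hκ0, by positivity, fun u hu => ?_⟩
  obtain ⟨c, hE⟩ := hc u hu
  have hw := (quot_C1c hΩ hφ.1 hφ.2.1 hu).1
  have hQ : 0 ≤ Qf p V u := nonneg_C1 hp hΩ hV hn hu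
  set E := ∫ x in U, |u x / φ x - c| ^ p with hEdef
  set A := ∫ x in U, |u x / φ x| ^ p with hA
  have iE : IntegrableOn (fun x => |u x / φ x - c| ^ p) U :=
    integrableOn_bdd (continuous_abs_rpow hp (hw.1.continuous.sub continuous_const)) hUc
  have iA : IntegrableOn (fun x => |u x / φ x| ^ p) U :=
    integrableOn_bdd (continuous_abs_rpow hp hw.1.continuous) hUc
  have ic : IntegrableOn (fun _ : Ed d => |c| ^ p) U :=
    integrableOn_bdd continuous_const hUc
  have i1 : IntegrableOn (fun _ : Ed d => M') U := integrableOn_bdd continuous_const hUc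
  have ih : IntegrableOn h U := Integrable.mono' i1 hm hMM
  have ihA : IntegrableOn (fun x => h x * |u x / φ x| ^ p) U :=
    iA.bdd_mul hm hMM
  have h3 : A ≤ C1 * (E + vol * |c| ^ p) := by
    have e : C1 * (E + vol * |c| ^ p) =
        ∫ x in U, C1 * (|u x / φ x - c| ^ p + |c| ^ p) := by
      rw [integral_const_mul, integral_add iE ic, setIntegral_const, smul_eq_mul]
    rw [e]
    refine integral_mono iA ((iE.add ic).const_mul C1) fun x => ?_
    have := h1 (u x / φ x - c) c
    simpa using this
  have hc0 : 0 ≤ |c| ^ p := by positivity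
  have h4 : I * |c| ^ p - (∫ x in U, h x * |u x / φ x| ^ p) ≤
      M' * (δ * (vol * |c| ^ p) + C2 * E) := by
    have e : M' * (δ * (vol * |c| ^ p) + C2 * E) =
        ∫ x in U, M' * (δ * |c| ^ p + C2 * |u x / φ x - c| ^ p) := by
      rw [integral_const_mul, integral_add (ic.const_mul δ) (iE.const_mul C2), setIntegral_const,
        integral_const_mul, smul_eq_mul]
      ring
    have e' : I * |c| ^ p - (∫ x in U, h x * |u x / φ x| ^ p) =
        ∫ x in U, (h x * |c| ^ p - h x * |u x / φ x| ^ p) := by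
      rw [integral_sub (ih.mul_const _) ihA, integral_mul_const]
    rw [e, e']
    refine integral_mono_ae ((ih.mul_const _).sub ihA)
      (((ic.const_mul δ).add (iE.const_mul C2)).const_mul M') ?_
    filter_upwards [hMM] with x hx
    have h5 := h2 c (u x / φ x)
    rw [abs_sub_comm c] at h5
    calc h x * |c| ^ p - h x * |u x / φ x| ^ p = h x * (|c| ^ p - |u x / φ x| ^ p) := by ring
      _ ≤ |h x| * |(|c| ^ p - |u x / φ x| ^ p)| := by rw [← abs_mul]; exact le_abs_self _
      _ ≤ _ := mul_le_mul hx h5 (abs_nonneg _) hM'0.le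
  have h5 : M' * δ * vol ≤ I / 4 := by
    rw [hδ]
    have : M' * (I / (4 * M' * (vol + 1))) * vol = I / 4 * (vol / (vol + 1)) := by
      field_simp
    rw [this]
    have : vol / (vol + 1) ≤ 1 := by rw [div_le_one (by positivity)]; linarith
    nlinarith
  have h6 : M' * C2 * η = I / 4 := by rw [hη]; field_simp
  have h7 : κ * (C1 * (η + vol)) = I / 2 := by
    rw [hκ]; field_simp
  have h8 : κ * A ≤ κ * (C1 * (C * Qf p V u + η * |c| ^ p + vol * |c| ^ p)) := by
    gcongr
    refine h3.trans ?_
    gcongr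
  have h9 : M' * C2 * E ≤ M' * C2 * (C * Qf p V u + η * |c| ^ p) := by gcongr
  have h10 := mul_le_mul_of_nonneg_right h5 hc0
  have h11 : M' * C2 * η * |c| ^ p = I / 4 * |c| ^ p := by rw [h6]
  have h12 : κ * (C1 * (η + vol)) * |c| ^ p = I / 2 * |c| ^ p := by rw [h7]
  nlinarith

lemma phi_bdd {φ : Ed d → ℝ} (hc : ContinuousOn φ Ω) (hpos : ∀ x ∈ Ω, 0 < φ x) {K : Set (Ed d)}
    (hK : IsCompact K) (hKΩ : K ⊆ Ω) : ∃ M : ℝ, 0 < M ∧ ∀ x ∈ K, φ x ≤ M := by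
  obtain ⟨M, hM⟩ := hK.exists_bound_of_continuousOn (hc.mono hKΩ)
  exact ⟨|M| + 1, by positivity, fun x hx => by
    have := hM x hx
    rw [Real.norm_eq_abs] at this
    linarith [le_abs_self (φ x), le_abs_self M]⟩

lemma locbdd_V0 {V₀ : Ed d → ℝ} (hΩ : IsOpen Ω) (hm : Measurable V₀)
    (hb : ∃ M : ℝ, ∀ᵐ x ∂(volume.restrict Ω), |V₀ x| ≤ M) : LocBddOn Ω V₀ := by
  obtain ⟨M, hM⟩ := hb
  refine ⟨hm, fun K _ hKΩ => ⟨M, ?_⟩⟩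
  rw [ae_restrict_iff' hΩ.measurableSet] at hM
  filter_upwards [hM] with x hx hxK using hx (hKΩ hxK)

lemma locbdd_add {V₀ : Ed d → ℝ} (hV : LocBddOn Ω V) (h0 : LocBddOn Ω V₀) (s : ℝ) :
    LocBddOn Ω (fun x => V x + s * V₀ x) := by
  refine ⟨hV.1.add (h0.1.const_mul s), fun K hK hKΩ => ?_⟩
  obtain ⟨M, hM⟩ := hV.2 K hK hKΩ
  obtain ⟨M', hM'⟩ := h0.2 K hK hKΩ
  refine ⟨M + |s| * M', ?_⟩
  filter_upwards [hM, hM'] with x h1 h2 hx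
  refine (abs_add_le _ _).trans (add_le_add (h1 hx) ?_)
  rw [abs_mul]
  exact mul_le_mul_of_nonneg_left (h2 hx) (abs_nonneg _)

lemma Qf_add {V₀ : Ed d → ℝ} (hp : 1 < p) (hV : LocBddOn Ω V) (h0 : LocBddOn Ω V₀) (s : ℝ)
    {u : Ed d → ℝ} (hu : C1c Ω u) :
    Qf p (fun x => V x + s * V₀ x) u = Qf p V u + s * ∫ x, V₀ x * |u x| ^ p := by
  rw [Qf_eq hp (locbdd_add hV h0 s) hu, Qf_eq hp hV hu, add_assoc]
  congr 1
  rw [← integral_const_mul, ← integral_add (integrable_Vabsp hp hV hu)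
    ((integrable_Vabsp hp h0 hu).const_mul s)]
  congr 1; ext x; ring

lemma loc_subcrit (hp : 1 < p) (hΩ : IsOpen Ω) (hcn : IsConnected Ω)
    (hV : LocBddOn Ω V) (hn : NonnegOn p Ω V)
    {φ : Ed d → ℝ} (hφ : IsGroundStateOn p Ω V φ) {V₀ : Ed d → ℝ} (h0 : LocBddOn Ω V₀)
    {K : Set (Ed d)} (hK : IsCompact K) (hKΩ : K ⊆ Ω) (hKs : Function.support V₀ ⊆ K)
    (hI : 0 < ∫ x in Ω, V₀ x * φ x ^ p) :
    ∃ s₀ : ℝ, 0 < s₀ ∧ ∀ s : ℝ, 0 < s → s < s₀ → ∀ K' : Set (Ed d), IsCompact K' → K' ⊆ Ω →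
      ∃ ε : ℝ, 0 < ε ∧ ∀ u, C1c Ω u →
        ε * ∫ x in K', |u x| ^ p ≤ Qf p (fun x => V x + s * V₀ x) u := by
  have hp0 : 0 < p := by linarith
  obtain ⟨x₀, hx₀⟩ := hcn.nonempty
  obtain ⟨U, hU, hxU, hKU⟩ := poin_compact hp hΩ hcn hx₀ hK hKΩ
  have hUΩ : U ⊆ Ω := subset_closure.trans hU.2.2.1
  have hUm := hU.1.measurableSet
  have hφc : ContinuousOn φ Ω := hφ.1.continuousOn
  have hV0z : ∀ x, x ∉ U → V₀ x = 0 := fun x hx => by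
    by_contra hne; exact hx (hKU (hKs hne))
  obtain ⟨M, hM0, hM⟩ := phi_bdd hφc hφ.2.1 hU.2.1 hU.2.2.1
  obtain ⟨M0, hM0'⟩ := h0.2 _ hU.2.1 hU.2.2.1
  have hm : AEStronglyMeasurable (fun x => V₀ x * φ x ^ p) (volume.restrict U) := by
    refine h0.1.aestronglyMeasurable.mul ?_
    exact ((hφc.mono hUΩ).rpow_const (fun x _ => Or.inr hp0.le)).aestronglyMeasurable hUm
  have hb : ∀ᵐ x ∂(volume.restrict U), |V₀ x * φ x ^ p| ≤ |M0| * M ^ p := by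
    rw [ae_restrict_iff' hUm]
    filter_upwards [hM0'] with x hx hxU
    have h1 : 0 < φ x := hφ.2.1 x (hUΩ hxU)
    rw [abs_mul, abs_of_nonneg (Real.rpow_nonneg h1.le p)]
    refine mul_le_mul ((hx (subset_closure hxU)).trans (le_abs_self _))
      (Real.rpow_le_rpow h1.le (hM x (subset_closure hxU)) hp0.le) (by positivity) (abs_nonneg _)
  have hIU : 0 < ∫ x in U, V₀ x * φ x ^ p := by
    rwa [setIntegral_eq_of_subset_of_forall_diff_eq_zero hΩ.measurableSet hUΩ
      (fun x hx => by rw [hV0z x hx.2, zero_mul])] at hI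
  obtain ⟨κ, C, hκ, hC, hmain⟩ := weight_bound hp hΩ hV hn hφ hU hm hb hIU
  have hmain' : ∀ u, C1c Ω u → κ * ∫ x in U, |u x / φ x| ^ p ≤
      (∫ x, V₀ x * |u x| ^ p) + C * Qf p V u := by
    intro u hu
    have : ∫ x in U, V₀ x * φ x ^ p * |u x / φ x| ^ p = ∫ x, V₀ x * |u x| ^ p := by
      rw [← setIntegral_eq_integral_of_forall_compl_eq_zero (s := U)
        (f := fun x => V₀ x * |u x| ^ p) (fun x hx => by rw [hV0z x hx, zero_mul])]
      refine setIntegral_congr_fun hUm fun x hx => ?_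
      have h1 : 0 < φ x := hφ.2.1 x (hUΩ hx)
      show V₀ x * φ x ^ p * |u x / φ x| ^ p = V₀ x * |u x| ^ p
      rw [mul_assoc, ← Real.mul_rpow h1.le (abs_nonneg _), abs_div, abs_of_pos h1,
        mul_div_cancel₀ _ h1.ne']
    rw [← this]
    exact hmain u hu
  refine ⟨1 / C, by positivity, fun s hs hsC K' hK' hK'Ω => ?_⟩
  rw [lt_div_iff₀ hC] at hsC
  obtain ⟨U', hU', _, hKU'⟩ := poin_compact hp hΩ hcn hx₀ (hK'.union hU.2.1)
    (Set.union_subset hK'Ω hU.2.2.1)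
  have hU'm := hU'.1.measurableSet
  have hU'Ω : U' ⊆ Ω := subset_closure.trans hU'.2.2.1
  have hUU' : U ⊆ U' := subset_closure.trans (Set.subset_union_right.trans hKU')
  have hvolU : 0 < volume.real U := by
    refine ENNReal.toReal_pos (hU.1.measure_pos _ ⟨x₀, hxU⟩).ne' ?_
    exact ((measure_mono subset_closure).trans_lt hU.2.1.measure_lt_top).ne
  obtain ⟨κ', C', hκ', hC', hmain2⟩ := weight_bound hp hΩ hV hn hφ hU'
    (h := U.indicator fun _ => (1:ℝ)) (M := 1)
    ((measurable_const.indicator hUm).aestronglyMeasurable)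
    (Eventually.of_forall fun x => by
      by_cases hx : x ∈ U <;> simp [hx])
    (by
      rw [setIntegral_indicator hUm, Set.inter_eq_right.2 hUU', setIntegral_const]
      simpa using hvolU)
  obtain ⟨M2, hM20, hM2⟩ := phi_bdd hφc hφ.2.1 hK' hK'Ω
  set a := min ((1 - s * C) / C') (s * κ) with ha
  have ha0 : 0 < a := lt_min (div_pos (by linarith) hC') (by positivity)
  refine ⟨a * κ' / M2 ^ p, by positivity, fun u hu => ?_⟩
  have hQ : 0 ≤ Qf p V u := nonneg_C1 hp hΩ hV hn hu
  have hw := (quot_C1c hΩ hφ.1 hφ.2.1 hu).1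
  have A1 := hmain' u hu
  have A2 := hmain2 u hu
  have e : ∫ x in U', U.indicator (fun _ => (1:ℝ)) x * |u x / φ x| ^ p =
      ∫ x in U, |u x / φ x| ^ p := by
    have : ∀ x, U.indicator (fun _ => (1:ℝ)) x * |u x / φ x| ^ p =
        U.indicator (fun x => |u x / φ x| ^ p) x := fun x => by
      by_cases hx : x ∈ U <;> simp [hx]
    simp only [this]
    rw [setIntegral_indicator hUm, Set.inter_eq_right.2 hUU']
  rw [e] at A2
  rw [Qf_add hp hV h0 s hu]
  set P := ∫ x in U, |u x / φ x| ^ p with hP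
  have hP0 : 0 ≤ P := integral_nonneg fun x => by positivity
  have A3 : ∫ x in K', |u x| ^ p ≤ M2 ^ p * ∫ x in U', |u x / φ x| ^ p := by
    have iA : IntegrableOn (fun x => |u x / φ x| ^ p) U' :=
      integrableOn_bdd (continuous_abs_rpow hp hw.1.continuous) hU'.2.1
    calc ∫ x in K', |u x| ^ p ≤ ∫ x in K', M2 ^ p * |u x / φ x| ^ p := by
          refine setIntegral_mono_on ((continuous_abs_rpow hp hu.1.continuous).continuousOn.integrableOn_compact hK')
            ((iA.mono_set (Set.subset_union_left.trans hKU')).const_mul _) hK'.measurableSet fun x hx => ?_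
          have h1 : 0 < φ x := hφ.2.1 x (hK'Ω hx)
          rw [← Real.mul_rpow hM20.le (abs_nonneg _)]
          refine Real.rpow_le_rpow (abs_nonneg _) ?_ hp0.le
          rw [abs_div, abs_of_pos h1, ← mul_div_assoc, le_div_iff₀ h1, mul_comm]
          exact mul_le_mul_of_nonneg_right (hM2 x hx) (abs_nonneg _)
      _ = M2 ^ p * ∫ x in K', |u x / φ x| ^ p := integral_const_mul _ _
      _ ≤ _ := by
          refine mul_le_mul_of_nonneg_left ?_ (by positivity)
          exact setIntegral_mono_set iA (Eventually.of_forall fun x => by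
            show (0:ℝ) ≤ |u x / φ x| ^ p
            positivity) (HasSubset.Subset.eventuallyLE (Set.subset_union_left.trans hKU'))
  have hM2p : 0 < M2 ^ p := by positivity
  calc a * κ' / M2 ^ p * ∫ x in K', |u x| ^ p
      ≤ a * κ' / M2 ^ p * (M2 ^ p * ∫ x in U', |u x / φ x| ^ p) := by gcongr
    _ = a * (κ' * ∫ x in U', |u x / φ x| ^ p) := by field_simp
    _ ≤ a * (P + C' * Qf p V u) := by gcongr
    _ ≤ s * κ * P + (1 - s * C) / C' * (C' * Qf p V u) := by
        rw [mul_add]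
        exact add_le_add (mul_le_mul_of_nonneg_right (min_le_right _ _) hP0)
          (mul_le_mul_of_nonneg_right (min_le_left _ _) (by positivity))
    _ = s * (κ * P) + (1 - s * C) * Qf p V u := by field_simp
    _ ≤ s * ((∫ x, V₀ x * |u x| ^ p) + C * Qf p V u) + (1 - s * C) * Qf p V u := by gcongr
    _ = _ := by ring

end subcrit

section fin
variable {d : ℕ} {Ω : Set (Ed d)} {V : Ed d → ℝ} {p : ℝ}

lemma build_W (hp : 1 < p) (hΩ : IsOpen Ω) (hne : Ω.Nonempty) {Q : (Ed d → ℝ) → ℝ}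
    (h : ∀ K' : Set (Ed d), IsCompact K' → K' ⊆ Ω → ∃ ε : ℝ, 0 < ε ∧ ∀ u, C1c Ω u →
        ε * ∫ x in K', |u x| ^ p ≤ Q u) :
    ∃ W : Ed d → ℝ, ContinuousOn W Ω ∧ (∀ x ∈ Ω, 0 < W x) ∧
    ∀ u, C1c Ω u → (∫ x in Ω, W x * |u x| ^ p) ≤ Q u := by
  have hr : ∀ x : Ed d, ∃ r : ℝ, 0 < r ∧ r ≤ 1 ∧ (x ∈ Ω → Metric.closedBall x r ⊆ Ω) := by
    intro x
    by_cases hx : x ∈ Ω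
    · obtain ⟨r, hr, hrΩ⟩ := Metric.nhds_basis_closedBall.mem_iff.1 (hΩ.mem_nhds hx)
      exact ⟨min r 1, lt_min hr one_pos, min_le_right _ _, fun _ =>
        (Metric.closedBall_subset_closedBall (min_le_left _ _)).trans hrΩ⟩
    · exact ⟨1, one_pos, le_rfl, fun h => absurd h hx⟩
  choose r hr0 hr1 hrΩ using hr
  obtain ⟨t, htΩ, htc, ht⟩ := TopologicalSpace.countable_cover_nhdsWithin
    (s := Ω) (f := fun x => Metric.ball x (r x))
    (fun x _ => mem_nhdsWithin_of_mem_nhds (Metric.ball_mem_nhds x (hr0 x)))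
  have htne : t.Nonempty := by
    obtain ⟨x, hx⟩ := hne
    obtain ⟨y, hy, _⟩ := Set.mem_iUnion₂.1 (ht hx)
    exact ⟨y, hy⟩
  obtain ⟨f, rfl⟩ := htc.exists_eq_range htne
  have hfΩ : ∀ j, f j ∈ Ω := fun j => htΩ ⟨j, rfl⟩
  have hε : ∀ j, ∃ ε : ℝ, 0 < ε ∧ ∀ u, C1c Ω u →
      ε * ∫ x in Metric.closedBall (f j) (r (f j)), |u x| ^ p ≤ Q u :=
    fun j => h _ (isCompact_closedBall _ _) (hrΩ _ (hfΩ j))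
  choose ε hε0 hε using hε
  set g : ℕ → Ed d → ℝ := fun j y =>
    (min (ε j) 1 * max 0 (r (f j) - dist y (f j))) * ((1:ℝ) / 2 / 2 ^ j) with hg
  have hgc : ∀ j, Continuous (g j) := fun j => by
    simp only [hg]
    fun_prop
  have hg0 : ∀ j y, 0 ≤ g j y := fun j y => by
    have := hε0 j
    simp only [hg]
    positivity
  have hmax1 : ∀ j y, max 0 (r (f j) - dist y (f j)) ≤ 1 := fun j y =>
    max_le zero_le_one (by linarith [hr1 (f j), dist_nonneg (x := y) (y := f j)])
  have hg1 : ∀ j y, g j y ≤ (1:ℝ) / 2 / 2 ^ j := fun j y => by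
    simp only [hg]
    have h1 : min (ε j) 1 * max 0 (r (f j) - dist y (f j)) ≤ 1 :=
      mul_le_one₀ (min_le_right _ _) (le_max_left _ _) (hmax1 j y)
    exact mul_le_of_le_one_left (by positivity) h1
  have hgeo := hasSum_geometric_two' (1:ℝ)
  have hsum : ∀ y, Summable fun j => g j y := fun y =>
    Summable.of_nonneg_of_le (fun j => hg0 j y) (fun j => hg1 j y) hgeo.summable
  refine ⟨fun y => ∑' j, g j y, ?_, ?_, ?_⟩
  · refine Continuous.continuousOn (continuous_tsum hgc hgeo.summable fun j y => ?_)
    rw [Real.norm_of_nonneg (hg0 j y)]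
    exact hg1 j y
  · intro x hx
    obtain ⟨y, ⟨j, rfl⟩, hy⟩ := Set.mem_iUnion₂.1 (ht hx)
    refine (hsum x).tsum_pos (fun j => hg0 j x) j ?_
    have h1 : 0 < r (f j) - dist x (f j) := by
      have := Metric.mem_ball.1 hy
      linarith
    have := hε0 j
    simp only [hg]
    have h2 : 0 < max 0 (r (f j) - dist x (f j)) := lt_max_of_lt_right h1
    positivity
  · intro u hu
    have hu0 : ∀ x, x ∉ tsupport u → |u x| ^ p = 0 := fun x hx => absp_zero hp hx
    rw [setIntegral_eq_integral_of_forall_compl_eq_zero (fun x hx => by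
      rw [hu0 x (fun h => hx (hu.2.2 h)), mul_zero])]
    have hF : ∀ j, Integrable fun x => g j x * |u x| ^ p := fun j =>
      integrable_of_K ((hgc j).mul (continuous_abs_rpow hp hu.1.continuous)) hu.2.1
        (fun x hx => by rw [hu0 x hx, mul_zero])
    have hb : ∀ j, ∫ x, g j x * |u x| ^ p ≤ Q u * ((1:ℝ) / 2 / 2 ^ j) := by
      intro j
      have hz : ∀ x, x ∉ Metric.closedBall (f j) (r (f j)) → g j x * |u x| ^ p = 0 := by
        intro x hx
        rw [Metric.mem_closedBall, not_le] at hx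
        simp only [hg]
        rw [max_eq_left (by linarith)]
        simp
      rw [← setIntegral_eq_integral_of_forall_compl_eq_zero hz]
      have hi : IntegrableOn (fun x => |u x| ^ p) (Metric.closedBall (f j) (r (f j))) :=
        (integrable_absp hp hu).integrableOn
      calc ∫ x in Metric.closedBall (f j) (r (f j)), g j x * |u x| ^ p
          ≤ ∫ x in Metric.closedBall (f j) (r (f j)), (ε j * |u x| ^ p) * ((1:ℝ) / 2 / 2 ^ j) := by
            refine integral_mono (hF j).integrableOn ((hi.const_mul _).mul_const _) fun x => ?_
            have h1 : min (ε j) 1 * max 0 (r (f j) - dist x (f j)) ≤ ε j * 1 :=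
              mul_le_mul (min_le_left _ _) (hmax1 j x) (le_max_left _ _) (hε0 j).le
            have h2 : 0 ≤ |u x| ^ p * ((1:ℝ) / 2 / 2 ^ j) := by positivity
            have h3 := mul_le_mul_of_nonneg_right h1 h2
            simp only [hg]
            linarith
        _ = (ε j * ∫ x in Metric.closedBall (f j) (r (f j)), |u x| ^ p) * ((1:ℝ) / 2 / 2 ^ j) := by
            rw [integral_mul_const, integral_const_mul]
        _ ≤ _ := mul_le_mul_of_nonneg_right (hε j u hu) (by positivity)
    have hn : ∀ j, ∫ x, ‖g j x * |u x| ^ p‖ = ∫ x, g j x * |u x| ^ p := fun j => by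
      congr 1; ext x
      exact Real.norm_of_nonneg (mul_nonneg (hg0 j x) (by positivity))
    have hS : Summable fun j => ∫ x, ‖g j x * |u x| ^ p‖ := by
      refine Summable.of_nonneg_of_le (fun j => integral_nonneg fun x => norm_nonneg _)
        (fun j => (hn j).trans_le (hb j)) (hgeo.summable.mul_left (Q u))
    have hH := hasSum_integral_of_summable_integral_norm hF hS
    simp only [tsum_mul_right] at hH
    have := hasSum_le hb hH (hgeo.mul_left (Q u))
    simpa using this

lemma pos_of_sub (hp : 1 < p) (hΩ : IsOpen Ω) (hV : LocBddOn Ω V)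
    {φ : Ed d → ℝ} (hφ : IsGroundStateOn p Ω V φ) {V₀ : Ed d → ℝ} (h0 : LocBddOn Ω V₀)
    {K : Set (Ed d)} (hK : IsCompact K) (hKΩ : K ⊆ Ω) (hKs : Function.support V₀ ⊆ K)
    {s : ℝ} (hs : 0 < s) (hsub : SubcriticalOn p Ω (fun x => V x + s * V₀ x)) :
    0 < ∫ x in Ω, V₀ x * φ x ^ p := by
  have hp0 : 0 < p := by linarith
  obtain ⟨hφ1, hφpos, un, ⟨ht, hun0, ⟨B, hBo, hBc, hBΩ, hB1⟩, hQ⟩, hlim⟩ := hφ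
  obtain ⟨W, hWc, hWpos, hW⟩ := hsub
  have hV0z : ∀ x, x ∉ K → V₀ x = 0 := fun x hx => by
    by_contra hne; exact hx (hKs hne)
  have hBne : (closure B).Nonempty := by
    rw [closure_nonempty_iff]
    by_contra hB
    rw [Set.not_nonempty_iff_eq_empty] at hB
    have := hB1 0
    simp [hB] at this
  obtain ⟨y, hy, hmin⟩ := hBc.exists_isMinOn hBne (hWc.mono hBΩ)
  have hω : 0 < W y := hWpos y (hBΩ hy)
  set ω := W y with hωd
  have hφc : ContinuousOn φ Ω := hφ1.continuousOn
  by_contra hneg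
  rw [not_lt] at hneg
  rw [setIntegral_eq_of_subset_of_forall_diff_eq_zero hΩ.measurableSet hKΩ
      (fun x hx => by rw [hV0z x hx.2, zero_mul])] at hneg
  obtain ⟨M, hM⟩ := h0.2 K hK hKΩ
  set M' := |M| + 1 with hM'
  have hM'0 : 0 < M' := by positivity
  have hMM : ∀ᵐ x ∂(volume.restrict K), |V₀ x| ≤ M' := by
    rw [ae_restrict_iff' hK.measurableSet]
    filter_upwards [hM] with x hx hxK
    have := le_abs_self M
    linarith [hx hxK]
  have cφ : ContinuousOn (fun x => |φ x| ^ p) K :=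
    ((hφc.mono hKΩ).abs).rpow_const (fun x _ => Or.inr hp0.le)
  have iφ : IntegrableOn (fun x => |φ x| ^ p) K := cφ.integrableOn_compact hK
  set A := ∫ x in K, |φ x| ^ p with hA
  have hA0 : 0 ≤ A := integral_nonneg fun x => by positivity
  set δ := ω / (4 * s * M' * (A + 1)) with hδ
  have hδ0 : 0 < δ := by positivity
  obtain ⟨C, hC, hc⟩ := abs_rpow_diff hp hδ0
  have key : ∀ n, ω ≤ Qp p Ω V (un n) + s * (M' * (δ * A + C * ∫ x in K, |un n x - φ x| ^ p)) := by
    intro n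
    have hu := (ht n).c1c
    have h1 := hW _ (ht n)
    rw [Qp_eq hp hu.2.2, Qf_add hp hV h0 s hu, ← Qp_eq hp hu.2.2] at h1
    have hu0 : ∀ x, x ∉ tsupport (un n) → |un n x| ^ p = 0 := fun x hx => absp_zero hp hx
    have iW : IntegrableOn (fun x => W x * |un n x| ^ p) Ω := by
      have h2 : IntegrableOn (fun x => W x * |un n x| ^ p) (tsupport (un n)) :=
        ((hWc.mono hu.2.2).mul (continuous_abs_rpow hp hu.1.continuous).continuousOn).integrableOn_compact
          hu.2.1
      exact h2.of_forall_diff_eq_zero hΩ.measurableSet fun x hx => by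
        rw [hu0 x hx.2, mul_zero]
    have h3 : ω ≤ ∫ x in Ω, W x * |un n x| ^ p := by
      calc ω = ∫ x in B, ω * |un n x| ^ p := by rw [integral_const_mul, hB1 n, mul_one]
        _ ≤ ∫ x in B, W x * |un n x| ^ p := by
            refine setIntegral_mono_on ((integrable_absp hp hu).integrableOn.const_mul _)
              (iW.mono_set (subset_closure.trans hBΩ)) hBo.measurableSet fun x hx => ?_
            exact mul_le_mul_of_nonneg_right (hmin (subset_closure hx)) (by positivity)
        _ ≤ _ := by
            refine setIntegral_mono_set iW ?_
              (HasSubset.Subset.eventuallyLE (subset_closure.trans hBΩ))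
            filter_upwards [ae_restrict_mem hΩ.measurableSet] with x hx
            exact mul_nonneg (hWpos x hx).le (by positivity)
    have h4 : ∫ x, V₀ x * |un n x| ^ p = ∫ x in K, V₀ x * |un n x| ^ p :=
      (setIntegral_eq_integral_of_forall_compl_eq_zero
        (fun x hx => by rw [hV0z x hx, zero_mul])).symm
    have cE : ContinuousOn (fun x => |un n x - φ x| ^ p) K :=
      ((hu.1.continuous.continuousOn.sub (hφc.mono hKΩ)).abs).rpow_const
        (fun x _ => Or.inr hp0.le)
    have iE : IntegrableOn (fun x => |un n x - φ x| ^ p) K := cE.integrableOn_compact hK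
    have iV1 : IntegrableOn (fun x => V₀ x * |un n x| ^ p) K :=
      (integrable_Vabsp hp h0 hu).integrableOn
    have iV2 : IntegrableOn (fun x => V₀ x * |φ x| ^ p) K :=
      Integrable.bdd_mul iφ h0.1.aestronglyMeasurable hMM
    have h5 : (∫ x in K, V₀ x * |un n x| ^ p) - (∫ x in K, V₀ x * |φ x| ^ p) ≤
        M' * (δ * A + C * ∫ x in K, |un n x - φ x| ^ p) := by
      have e : M' * (δ * A + C * ∫ x in K, |un n x - φ x| ^ p) =
          ∫ x in K, M' * (δ * |φ x| ^ p + C * |un n x - φ x| ^ p) := by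
        rw [integral_const_mul, integral_add (iφ.const_mul δ) (iE.const_mul C),
          integral_const_mul, integral_const_mul]
      rw [e, ← integral_sub iV1 iV2]
      refine integral_mono_ae (iV1.sub iV2)
        (((iφ.const_mul δ).add (iE.const_mul C)).const_mul M') ?_
      filter_upwards [hMM] with x hx
      have h5 := hc (φ x) (un n x)
      rw [abs_sub_comm (φ x), abs_sub_comm] at h5
      calc V₀ x * |un n x| ^ p - V₀ x * |φ x| ^ p = V₀ x * (|un n x| ^ p - |φ x| ^ p) := by ring
        _ ≤ |V₀ x| * |(|un n x| ^ p - |φ x| ^ p)| := by rw [← abs_mul]; exact le_abs_self _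
        _ ≤ _ := mul_le_mul hx h5 (abs_nonneg _) hM'0.le
    have h6 : ∫ x in K, V₀ x * |φ x| ^ p = ∫ x in K, V₀ x * φ x ^ p :=
      setIntegral_congr_fun hK.measurableSet fun x hx => by
        show V₀ x * |φ x| ^ p = V₀ x * φ x ^ p
        rw [abs_of_pos (hφpos x (hKΩ hx))]
    rw [h6] at h5
    rw [h4] at h1
    have h7 : ∫ x in K, V₀ x * |un n x| ^ p ≤
        M' * (δ * A + C * ∫ x in K, |un n x - φ x| ^ p) := by linarith
    have h8 := mul_le_mul_of_nonneg_left h7 hs.le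
    linarith
  have hT : Tendsto (fun n => Qp p Ω V (un n) +
      s * (M' * (δ * A + C * ∫ x in K, |un n x - φ x| ^ p))) atTop
      (𝓝 (0 + s * (M' * (δ * A + C * 0)))) :=
    hQ.add ((((hlim K hK hKΩ).const_mul C).const_add (δ * A)).const_mul M' |>.const_mul s)
  have h9 : ω ≤ 0 + s * (M' * (δ * A + C * 0)) := ge_of_tendsto' hT key
  have h10 : s * (M' * (δ * A)) = ω / 4 * (A / (A + 1)) := by
    rw [hδ]; field_simp
  have h11 : A / (A + 1) ≤ 1 := by rw [div_le_one (by positivity)]; linarith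
  rw [mul_zero, add_zero, zero_add, h10] at h9
  nlinarith

end fin

/-- Proposition 13.12: let `Q_V` be critical in Ω with ground state `φ₀`, and let
`V₀ ∈ L^∞(Ω)` have compact support in Ω. Then there exists `τ₊ ∈ (0,∞]` such that
`Q_{V+sV₀}` is subcritical in Ω for all `s ∈ (0,τ₊)` iff `∫_Ω V₀ φ₀^p dx > 0`. -/
theorem stmt19 (d : ℕ) (p : ℝ) (hp : 1 < p) (Ω : Set (Ed d))
    (hopen : IsOpen Ω) (hconn : IsConnected Ω)
    (V : Ed d → ℝ) (hV : LocBddOn Ω V)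
    (hcrit : CriticalOn p Ω V)
    (φ₀ : Ed d → ℝ) (hgs : IsGroundStateOn p Ω V φ₀)
    (V₀ : Ed d → ℝ) (hV₀m : Measurable V₀)
    (hV₀bdd : ∃ M : ℝ, ∀ᵐ x ∂(volume.restrict Ω), |V₀ x| ≤ M)
    (hV₀supp : ∃ K : Set (Ed d), IsCompact K ∧ K ⊆ Ω ∧ Function.support V₀ ⊆ K) :
    (∃ τp : EReal, 0 < τp ∧ ∀ s : ℝ, 0 < s → (s : EReal) < τp →
        SubcriticalOn p Ω (fun x => V x + s * V₀ x)) ↔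
      0 < ∫ x in Ω, V₀ x * φ₀ x ^ p := by
  obtain ⟨K, hK, hKΩ, hKs⟩ := hV₀supp
  have h0 : LocBddOn Ω V₀ := locbdd_V0 hopen hV₀m hV₀bdd
  constructor
  · rintro ⟨τ, hτ, h⟩
    obtain ⟨s, hs0, hsτ⟩ := EReal.lt_iff_exists_real_btwn.1 hτ
    have hs : 0 < s := by exact_mod_cast hs0
    exact pos_of_sub hp hopen hV hgs h0 hK hKΩ hKs hs (h s hs hsτ)
  · intro hI
    obtain ⟨s₀, hs₀, h⟩ := loc_subcrit hp hopen hconn hV hcrit.1 hgs h0 hK hKΩ hKs hI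
    refine ⟨(s₀ : EReal), by exact_mod_cast hs₀, fun s hs hss => ?_⟩
    have hss' : s < s₀ := by exact_mod_cast hss
    obtain ⟨W, hW1, hW2, hW3⟩ := build_W hp hopen hconn.nonempty (h s hs hss')
    refine ⟨W, hW1, hW2, fun u hu => ?_⟩
    rw [Qp_eq hp hu.2.2]
    exact hW3 u hu.c1c
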